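/- arXiv:2404.03952 — 4 statements merged into one kernel-verified Lean document; each statement's English description precedes it below -/
import Mathlib

section
/- Let $G$ be a finite group, let $S$ be a finite non-abelian simple group, let $r \ge 1$, and suppose $G$ has a normal subgroup $N$ isomorphic to the direct product $S^r$ of $r$ copies of $S$. Then $P(G) \ge r \cdot P(S)$, where $P(X)$ denotes the minimal faithful permutation degree of the finite group $X$. -/
/-- The minimal faithful permutation degree of a group `X`: the least `n` such that `X`
embeds in `Sym(n)`. -/
noncomputable def minFaithfulDegree (X : Type*) [Group X] : ℕ :=
  sInf {n : ℕ | ∃ f : X →* Equiv.Perm (Fin n), Function.Injective f}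

section MinFaithfulDegree

theorem minFaithfulDegree_le_card {X α : Type*} [Group X] [Finite α] (f : X →* Equiv.Perm α)
    (hf : Function.Injective f) : minFaithfulDegree X ≤ Nat.card α := by
  let g := (Finite.equivFin α).permCongrHom
  exact Nat.sInf_le ⟨g.toMonoidHom.comp f, g.injective.comp hf⟩

theorem exists_injective_perm_minFaithfulDegree (X : Type*) [Group X] [Finite X] :
    ∃ f : X →* Equiv.Perm (Fin (minFaithfulDegree X)), Function.Injective f := by
  let g := (Finite.equivFin X).permCongrHom
  exact Nat.sInf_mem (s := {n : ℕ | ∃ f : X →* Equiv.Perm (Fin n), Function.Injective f})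
    ⟨Nat.card X, g.toMonoidHom.comp (MulAction.toPermHom X X),
      g.injective.comp MulAction.toPerm_injective⟩

theorem two_le_minFaithfulDegree (X : Type*) [Group X] [Finite X] [Nontrivial X] :
    2 ≤ minFaithfulDegree X := by
  obtain ⟨f, hf⟩ := exists_injective_perm_minFaithfulDegree X
  by_contra! h
  have : Subsingleton (Fin (minFaithfulDegree X)) :=
    Fin.subsingleton_iff_le_one.2 (by omega)
  exact not_subsingleton X hf.subsingleton

theorem minFaithfulDegree_le_of_mulEquiv {X Y : Type*} [Group X] [Finite X] [Group Y]
    (e : Y ≃* X) : minFaithfulDegree Y ≤ minFaithfulDegree X := by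
  obtain ⟨f, hf⟩ := exists_injective_perm_minFaithfulDegree X
  exact Nat.sInf_le ⟨f.comp e.toMonoidHom, hf.comp e.injective⟩

theorem minFaithfulDegree_le_index {S : Type*} [Group S] [Finite S] [IsSimpleGroup S]
    {H : Subgroup S} (hH : H ≠ ⊤) : minFaithfulDegree S ≤ H.index := by
  refine minFaithfulDegree_le_card (MulAction.toPermHom S (S ⧸ H)) ?_
  rw [← MonoidHom.ker_eq_bot_iff, ← Subgroup.normalCore_eq_ker]
  exact H.normalCore_normal.eq_bot_or_eq_top.resolve_right
    fun h => hH (top_le_iff.1 (h ▸ H.normalCore_le))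

theorem two_mul_minFaithfulDegree_le_card {S : Type*} [Group S] [Finite S] [IsSimpleGroup S]
    (hS : ¬ ∀ a b : S, a * b = b * a) : 2 * minFaithfulDegree S ≤ Nat.card S := by
  obtain ⟨x, hx⟩ := exists_ne (1 : S)
  have htop : Subgroup.zpowers x ≠ ⊤ := fun h => hS fun a b => by
    obtain ⟨m, rfl⟩ := Subgroup.mem_zpowers_iff.1 (h ▸ Subgroup.mem_top a)
    obtain ⟨n, rfl⟩ := Subgroup.mem_zpowers_iff.1 (h ▸ Subgroup.mem_top b)
    exact zpow_mul_comm x m n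
  have hcard : 1 < Nat.card (Subgroup.zpowers x) :=
    Subgroup.one_lt_card_iff_ne_bot _ |>.2 (by simpa using hx)
  rw [← (Subgroup.zpowers x).card_mul_index]
  exact Nat.mul_le_mul hcard (minFaithfulDegree_le_index htop)

end MinFaithfulDegree

theorem Subgroup.relIndex_ne_zero_of_finite {G : Type*} [Group G] [Finite G]
    (H K : Subgroup G) : H.relIndex K ≠ 0 :=
  Subgroup.index_ne_zero_of_finite

theorem Subgroup.relIndex_sup_of_normal_right {G : Type*} [Group G] [Finite G]
    (H K : Subgroup G) [K.Normal] : H.relIndex (H ⊔ K) = H.relIndex K := by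
  have h₁ := Subgroup.relIndex_mul_relIndex (H ⊓ K) H (H ⊔ K) inf_le_left le_sup_left
  have h₂ := Subgroup.relIndex_mul_relIndex (H ⊓ K) K (H ⊔ K) inf_le_right le_sup_right
  rw [Subgroup.inf_relIndex_left] at h₁
  rw [Subgroup.inf_relIndex_right, Subgroup.relIndex_sup_right, ← h₁, mul_comm] at h₂
  exact (Nat.eq_of_mul_eq_mul_left (Nat.pos_of_ne_zero (K.relIndex_ne_zero_of_finite H)) h₂).symm

section SimpleFactors

variable {G S : Type*} [Group G] [Group S] [IsSimpleGroup S]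

theorem le_or_disjoint_of_conj_mem {A K : Subgroup G} (e : S ≃* A)
    (h : ∀ a ∈ A, ∀ x ∈ K, x ∈ A → a * x * a⁻¹ ∈ K) : A ≤ K ∨ Disjoint K A := by
  have := e.symm.isSimpleGroup
  have hn : (K.subgroupOf A).Normal := ⟨fun x hx a => h a a.2 x hx x.2⟩
  rcases hn.eq_bot_or_eq_top with h | h
  · exact .inr (Subgroup.subgroupOf_eq_bot.1 h)
  · exact .inl (Subgroup.subgroupOf_eq_top.1 h)

theorem eq_one_of_commute_of_mem {A : Subgroup G} (e : S ≃* A)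
    (hS : ¬ ∀ a b : S, a * b = b * a) {t : G} (ht : t ∈ A) (h : ∀ u ∈ A, t * u = u * t) :
    t = 1 := by
  have hz : Subgroup.center S = ⊥ := (inferInstance : (Subgroup.center S).Normal)
    |>.eq_bot_or_eq_top.resolve_right fun h => hS fun a b =>
      Subgroup.mem_center_iff.1 (h ▸ Subgroup.mem_top b) a
  have : e.symm ⟨t, ht⟩ ∈ Subgroup.center S := Subgroup.mem_center_iff.2 fun g => by
    apply e.injective
    ext
    simpa using (h (e g) (e g).2).symm
  rw [hz, Subgroup.mem_bot] at this
  simpa using this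

theorem minFaithfulDegree_le_relIndex [Finite S] {A H : Subgroup G} (e : S ≃* A)
    (h : ¬ A ≤ H) : minFaithfulDegree S ≤ H.relIndex A := by
  have := e.symm.isSimpleGroup
  have : Finite A := Finite.of_equiv S e.toEquiv
  exact (minFaithfulDegree_le_of_mulEquiv e).trans
    (minFaithfulDegree_le_index (mt Subgroup.subgroupOf_eq_top.1 h))

/-- If a simple subgroup `B` commutes with `A` and lies in `H ⊔ A` but not in `H`, then it meets
`H` trivially. -/
theorem disjoint_of_le_sup_of_commute {A B H : Subgroup G} [A.Normal] [B.Normal] (e : S ≃* B)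
    (hc : ∀ a ∈ A, ∀ b ∈ B, Commute a b) (hB : B ≤ H ⊔ A) (hBH : ¬ B ≤ H) : Disjoint H B := by
  refine (le_or_disjoint_of_conj_mem e fun u hu x hx hxB => ?_).resolve_left hBH
  obtain ⟨h, hh, a, ha, rfl⟩ := Subgroup.mem_sup_of_normal_right.1 (hB hu)
  have : h * a * x * (h * a)⁻¹ = h * x * h⁻¹ := by
    rw [mul_assoc h a x, (hc a ha x hxB).eq]
    group
  rw [this]
  exact H.mul_mem (H.mul_mem hh hx) (H.inv_mem hh)

/-- If `A`, `B`, `C` are pairwise commuting normal subgroups, `A` and `B` are isomorphic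
to the same non-abelian simple group, and `B` and `C` lie in `H ⊔ A`, then `H` contains `B` or `C`. -/
theorem le_or_le_of_le_sup_of_commute [Finite G] (hS : ¬ ∀ a b : S, a * b = b * a)
    {A B C H : Subgroup G} [A.Normal] [B.Normal] [C.Normal]
    (eA : S ≃* A) (eB : S ≃* B)
    (hAB : ∀ a ∈ A, ∀ b ∈ B, Commute a b) (hAC : ∀ a ∈ A, ∀ c ∈ C, Commute a c)
    (hBC : ∀ b ∈ B, ∀ c ∈ C, Commute b c) (hB : B ≤ H ⊔ A) (hC : C ≤ H ⊔ A) :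
    B ≤ H ∨ C ≤ H := by
  by_contra! hcon
  obtain ⟨hBH, hCH⟩ := hcon
  have dB := disjoint_of_le_sup_of_commute eB hAB hB hBH
  have hsup : H ⊔ A ≤ H ⊔ B := by
    rw [← Subgroup.relIndex_eq_one]
    have h := Subgroup.relIndex_mul_relIndex H (H ⊔ B) (H ⊔ A) le_sup_left
      (sup_le le_sup_left hB)
    have hcard : H.relIndex B = Nat.card B := by
      rw [← Subgroup.inf_relIndex_right, dB.eq_bot, Subgroup.relIndex_bot_left]
    have hle : H.relIndex A ≤ Nat.card B :=
      (Nat.le_of_dvd Nat.card_pos (H.relIndex_dvd_card A)).trans_eq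
        (Nat.card_congr (eA.symm.trans eB).toEquiv)
    rw [Subgroup.relIndex_sup_of_normal_right, Subgroup.relIndex_sup_of_normal_right, hcard] at h
    have h0 : (H ⊔ B).relIndex (H ⊔ A) ≠ 0 :=
      Subgroup.relIndex_ne_zero_of_finite _ _
    have hpos : 0 < Nat.card B := Nat.card_pos
    by_contra hne
    have : 2 ≤ (H ⊔ B).relIndex (H ⊔ A) := by omega
    nlinarith
  refine hCH fun s hs => ?_
  obtain ⟨x, hx, t, ht, rfl⟩ := Subgroup.mem_sup_of_normal_right.1 (hsup (hC hs))
  have hxA : ∀ a ∈ A, Commute a x := fun a ha => by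
    simpa using (hAC a ha _ hs).mul_right (hAB a ha t ht).inv_right
  suffices t = 1 by simpa [this] using hx
  refine eq_one_of_commute_of_mem eB hS ht fun u hu => ?_
  have hux : u * x * u⁻¹ ∈ H := by
    obtain ⟨h, hh, a, ha, rfl⟩ := Subgroup.mem_sup_of_normal_right.1 (hB hu)
    have : h * a * x * (h * a)⁻¹ = h * x * h⁻¹ := by
      rw [mul_assoc h a x, (hxA a ha).eq]
      group
    rw [this]
    exact H.mul_mem (H.mul_mem hh hx) (H.inv_mem hh)
  have hmem : x⁻¹ * (u * x * u⁻¹) ∈ H ⊓ B := by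
    refine ⟨H.mul_mem (H.inv_mem hx) hux, ?_⟩
    have := B.mul_mem (‹B.Normal›.conj_mem u hu x⁻¹) (B.inv_mem hu)
    simpa [mul_assoc] using this
  rw [dB.eq_bot, Subgroup.mem_bot, inv_mul_eq_one, eq_mul_inv_iff_mul_eq] at hmem
  have h := (hBC u hu _ hs).eq
  rw [← mul_assoc, ← hmem, mul_assoc, mul_assoc] at h
  exact (mul_left_cancel h).symm

open Classical in
/-- A subgroup containing none of a family of pairwise commuting normal non-abelian simple
subgroups of the same isomorphism type has large index. -/
theorem card_mul_minFaithfulDegree_le_index [Finite G] [Finite S]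
    (hS : ¬ ∀ a b : S, a * b = b * a) {ι : Type*} (A : ι → Subgroup G) [hA : ∀ i, (A i).Normal]
    (e : ∀ i, S ≃* A i) (hc : Pairwise fun i j => ∀ x ∈ A i, ∀ y ∈ A j, Commute x y)
    (s : Finset ι) (H : Subgroup G) (hs : ∀ i ∈ s, ¬ A i ≤ H) :
    s.card * minFaithfulDegree S ≤ H.index := by
  induction s using Finset.strongInduction generalizing H with
  | H s ih =>
  rcases s.eq_empty_or_nonempty with rfl | ⟨k, hk⟩
  · simp
  have hP := two_le_minFaithfulDegree S
  have hidx := Subgroup.relIndex_mul_index (le_sup_left : H ≤ H ⊔ A k)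
  have hpos : 0 < (H ⊔ A k).index := Nat.pos_of_ne_zero Subgroup.index_ne_zero_of_finite
  have hrel := minFaithfulDegree_le_relIndex (e k) (hs k hk)
  rw [Subgroup.relIndex_sup_of_normal_right] at hidx
  have hcard := Finset.card_erase_add_one hk
  by_cases hj : ∃ j ∈ s.erase k, A j ≤ H ⊔ A k
  · obtain ⟨j, hj, hjk⟩ := hj
    have hcard' := Finset.card_erase_add_one hj
    have hjs := Finset.mem_of_mem_erase hj
    have hkj : k ≠ j := (Finset.ne_of_mem_erase hj).symm
    have hrec := ih ((s.erase k).erase j)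
      ((Finset.erase_ssubset hj).trans (Finset.erase_ssubset hk)) (H ⊔ A k) fun i hi hik => by
        simp only [Finset.mem_erase] at hi
        exact (le_or_le_of_le_sup_of_commute hS (e k) (e j) (hc hkj) (hc (Ne.symm hi.2.1))
          (hc (Ne.symm hi.1)) hjk hik).elim (hs j hjs) (hs i hi.2.2)
    have hd := disjoint_of_le_sup_of_commute (e j) (hc hkj) hjk (hs j hjs)
    have hle : Nat.card S ≤ H.relIndex (A k) := by
      rw [← Subgroup.relIndex_sup_of_normal_right, Nat.card_congr (e j).toEquiv,
        ← Subgroup.relIndex_bot_left, ← hd.eq_bot, Subgroup.inf_relIndex_right]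
      exact Subgroup.relIndex_le_of_le_right hjk (Subgroup.relIndex_ne_zero_of_finite _ _)
    have h2 := (two_mul_minFaithfulDegree_le_card hS).trans hle
    rw [← hidx, ← hcard, ← hcard']
    generalize ((s.erase k).erase j).card = n at *
    have hn : n + 2 ≤ 2 * (H ⊔ A k).index := by nlinarith
    nlinarith
  · push Not at hj
    have hrec := ih (s.erase k) (Finset.erase_ssubset hk) (H ⊔ A k) hj
    rw [← hidx, ← hcard]
    generalize (s.erase k).card = n at *
    have hn : n + 1 ≤ (H ⊔ A k).index := by
      rcases n.eq_zero_or_pos with rfl | h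
      · omega
      · nlinarith
    nlinarith

end SimpleFactors

open Classical in
theorem card_mul_minFaithfulDegree_le_card {S ι α : Type*} [Group S] [Finite S] [IsSimpleGroup S]
    (hS : ¬ ∀ a b : S, a * b = b * a) [Fintype ι] [Finite α] [MulAction (ι → S) α]
    [FaithfulSMul (ι → S) α] : Fintype.card ι * minFaithfulDegree S ≤ Nat.card α := by
  let A : ι → Subgroup (ι → S) := fun i => (MonoidHom.mulSingle (fun _ => S) i).range
  have hA : ∀ i, (A i).Normal := fun i => ⟨by
    rintro _ ⟨x, rfl⟩ g
    refine ⟨g i * x * (g i)⁻¹, ?_⟩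
    ext j
    by_cases h : j = i
    · subst h; simp
    · simp [h]⟩
  have hinj : ∀ i, Function.Injective (MonoidHom.mulSingle (fun _ : ι => S) i) :=
    fun i => Pi.mulSingle_injective (M := fun _ => S) i
  have hc : Pairwise fun i j => ∀ x ∈ A i, ∀ y ∈ A j, Commute x y := by
    rintro i j hij _ ⟨x, rfl⟩ _ ⟨y, rfl⟩
    exact Pi.mulSingle_commute (f := fun _ => S) hij x y
  let Q := MulAction.orbitRel.Quotient (ι → S) α
  let _ : Fintype Q := Fintype.ofFinite _
  let T : Q → Finset ι := fun q => {i | ¬ A i ≤ MulAction.stabilizer (ι → S) q.out}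
  have hcover : Finset.univ ⊆ Finset.univ.biUnion T := by
    intro i _
    simp only [Finset.mem_biUnion, Finset.mem_univ, true_and, T, Finset.mem_filter]
    by_contra! h
    obtain ⟨x, hx⟩ := exists_ne (1 : S)
    refine hx (hinj i ?_)
    rw [map_one]
    refine FaithfulSMul.eq_of_smul_eq_smul (α := α) fun a => ?_
    obtain ⟨g, hg⟩ : a ∈ MulAction.orbit (ι → S) (Quotient.mk'' a : Q).out :=
      MulAction.orbitRel_apply.1
        ((MulAction.orbitRel (ι → S) α).symm (Quotient.mk_out (s := MulAction.orbitRel _ α) a))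
    have := h (Quotient.mk'' a) ((hA i).conj_mem _ ⟨x, rfl⟩ g⁻¹)
    rw [MulAction.mem_stabilizer_iff, inv_inv, mul_smul, mul_smul, inv_smul_eq_iff] at this
    dsimp only at hg
    rwa [hg, ← one_smul (ι → S) a, smul_smul, mul_one] at this
  calc Fintype.card ι * minFaithfulDegree S
      ≤ (∑ q, (T q).card) * minFaithfulDegree S := by
        gcongr
        exact (Finset.card_le_card hcover).trans Finset.card_biUnion_le
    _ = ∑ q, (T q).card * minFaithfulDegree S := Finset.sum_mul ..
    _ ≤ ∑ q : Q, (MulAction.stabilizer (ι → S) q.out).index :=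
        Finset.sum_le_sum fun q _ => card_mul_minFaithfulDegree_le_index hS A
          (fun i => (MonoidHom.ofInjective (hinj i))) hc _ _ fun i hi => by
            simpa [T] using hi
    _ = Nat.card α := by
        rw [Nat.card_congr (MulAction.selfEquivSigmaOrbitsQuotientStabilizer (ι → S) α),
          Nat.card_sigma]
        rfl

/-- If a finite group `G` has a normal subgroup isomorphic to `S^r` with `S` a finite
non-abelian simple group, then `P(G) ≥ r ⬝ P(S)`. -/
theorem minFaithfulDegree_ge_of_normal_pow_simple
    (G : Type*) [Group G] [Finite G] (S : Type*) [Group S] [Finite S]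
    (hsimple : IsSimpleGroup S) (hnonab : ¬ ∀ a b : S, a * b = b * a)
    (r : ℕ) (hr : 1 ≤ r) (N : Subgroup G) (hN : N.Normal)
    (e : N ≃* (Fin r → S)) :
    r * minFaithfulDegree S ≤ minFaithfulDegree G := by
  obtain ⟨f, hf⟩ := exists_injective_perm_minFaithfulDegree G
  let φ : (Fin r → S) →* Equiv.Perm (Fin (minFaithfulDegree G)) :=
    (f.comp N.subtype).comp e.symm.toMonoidHom
  have hφ : Function.Injective φ :=
    (hf.comp N.subtype_injective).comp e.symm.injective
  let _ : MulAction (Fin r → S) (Fin (minFaithfulDegree G)) := MulAction.compHom _ φ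
  have : FaithfulSMul (Fin r → S) (Fin (minFaithfulDegree G)) :=
    ⟨fun h => hφ (Equiv.ext h)⟩
  simpa using card_mul_minFaithfulDegree_le_card (ι := Fin r)
    (α := Fin (minFaithfulDegree G)) hnonab
end

section
/- Let $S = \mathrm{PSL}(3,4)$, the quotient of $\mathrm{SL}(3, \mathbb{F}_4)$ by its center. Then the minimal faithful permutation degree of $S$ is $P(S) = 21$ and the outer automorphism group of $S$ has order $|\mathrm{Out}(S)| = 12$; in particular $P(S) < 2\,|\mathrm{Out}(S)|$, so $S$ is a counterexample to the claim that $P(S) > 2|\mathrm{Out}(S)|$ for all finite simple groups other than $A_6$. -/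
open Matrix in
/-- `PSL(3,4)`: the quotient of `SL(3, 𝔽₄)` by its center, where `𝔽₄` is the field with
four elements. -/
abbrev PSL34 : Type _ := ProjectiveSpecialLinearGroup (Fin 3) (GaloisField 2 2)

/-- The order of the outer automorphism group of `S`, i.e. of the quotient of `Aut(S)` by
the subgroup of inner automorphisms. -/
noncomputable def outOrder (S : Type*) [Group S] : ℕ :=
  Nat.card (MulAut S ⧸ (MulAut.conj : S →* MulAut S).range)

theorem card_sylow_seven_aux {G : Type*} [Group G] [Finite G] {k : ℕ}
    (hG : Nat.card G = 7 * k) (hk : ¬ 7 ∣ k) [Fact (Nat.Prime 7)] :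
    7 ^ (Nat.card G).factorization 7 = 7 := by
  have hk0 : k ≠ 0 := by rintro rfl; simp at hk
  rw [hG, Nat.factorization_mul (by norm_num) hk0, Finsupp.add_apply,
    Nat.factorization_eq_zero_of_not_dvd hk, Nat.Prime.factorization_self Fact.out]
  rfl

/-- Sylow arithmetic rules out subgroups of index between `16` and `20`. -/
theorem index_not_mem_Icc {G : Type*} [Group G] [Finite G] (hG : Nat.card G = 20160)
    (hN : ∀ P : Subgroup G, Nat.card P = 7 → Nat.card (Subgroup.normalizer (P : Set G)) ≤ 21)
    (H : Subgroup G) (h16 : 16 ≤ H.index) (h20 : H.index ≤ 20) : False := by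
  have : Fact (Nat.Prime 7) := ⟨by norm_num⟩
  have hH := H.card_mul_index
  rw [hG] at hH
  obtain ⟨k, hk, hk7, hmod⟩ : ∃ k, Nat.card H = 7 * k ∧ ¬ 7 ∣ k ∧ ∀ a b, 7 * a * b = 7 * k →
      7 * a ≤ 21 → b % 7 ≠ 1 := by
    generalize Nat.card H = c at hH
    have key : ∀ k, k % 7 ≠ 0 → k % 7 ≠ 1 → k % 7 ≠ 2 → k % 7 ≠ 3 → ∀ a b, 7 * a * b = 7 * k →
        7 * a ≤ 21 → b % 7 ≠ 1 := by
      intro k h0 h1 h2 h3 a b hab ha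
      have ha : a ≤ 3 := by omega
      interval_cases a <;> omega
    generalize H.index = m at *
    interval_cases m
    · exact ⟨180, by omega, by omega, key _ (by omega) (by omega) (by omega) (by omega)⟩
    · omega
    · exact ⟨160, by omega, by omega, key _ (by omega) (by omega) (by omega) (by omega)⟩
    · omega
    · exact ⟨144, by omega, by omega, key _ (by omega) (by omega) (by omega) (by omega)⟩
  obtain ⟨Q⟩ : Nonempty (Sylow 7 H) := inferInstance
  have hQ : Nat.card Q = 7 := by
    rw [Sylow.card_eq_multiplicity, card_sylow_seven_aux hk hk7]
  have hcard := (Subgroup.normalizer (Q : Set H)).card_mul_index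
  rw [← Q.card_eq_index_normalizer, hk] at hcard
  obtain ⟨a, ha⟩ : 7 ∣ Nat.card (Subgroup.normalizer (Q : Set H)) :=
    (dvd_of_eq hQ.symm).trans
      (Subgroup.card_dvd_of_le (Subgroup.le_normalizer (H := (Q : Subgroup H))))
  have hle : Nat.card (Subgroup.normalizer (Q : Set H)) ≤ 21 := by
    refine le_trans ?_ (hN ((Q : Subgroup H).map H.subtype) ?_)
    · rw [← Subgroup.card_map_of_injective (K := Subgroup.normalizer (Q : Set H))
        H.subtype_injective]
      exact Subgroup.card_le_of_le (Subgroup.le_normalizer_map (H := (Q : Subgroup H)) _)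
    · rw [Subgroup.card_map_of_injective H.subtype_injective]
      exact hQ
  rw [ha] at hcard hle
  exact hmod a _ hcard hle (card_sylow_modEq_one 7 H)

open MulAction in
/-- In an action of a group of order `2 ^ k` all of whose nontrivial elements have the same number
of fixed points, the number of moved points is a multiple of `2 ^ k`. -/
theorem card_dvd_sub_card_fixedBy {E X : Type*} [Group E] [Finite E] [MulAction E X] [Finite X]
    (f : ℕ) (hf : ∀ e : E, e ≠ 1 → Nat.card (fixedBy X e) = f) (hfX : f ≤ Nat.card X) :
    Nat.card E ∣ Nat.card X - f := by
  classical
  have := Fintype.ofFinite E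
  have := Fintype.ofFinite X
  have := Fintype.ofFinite (Quotient (orbitRel E X))
  have h := sum_card_fixedBy_eq_card_orbits_mul_card_group E X
  have h1 : ∀ e : E, Fintype.card (fixedBy X e) = f + if e = 1 then Nat.card X - f else 0 := by
    intro e
    split_ifs with he
    · subst he
      rw [← Nat.card_eq_fintype_card, add_tsub_cancel_of_le hfX]
      simp
    · rw [← Nat.card_eq_fintype_card, hf e he, add_zero]
  rw [Finset.sum_congr rfl fun e _ => h1 e, Finset.sum_add_distrib, Finset.sum_const,
    Finset.sum_ite_eq' , if_pos (Finset.mem_univ _), Finset.card_univ, smul_eq_mul] at h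
  rw [Nat.card_eq_fintype_card (α := E)]
  exact (Nat.dvd_add_right (dvd_mul_right _ f)).1 (h ▸ dvd_mul_left _ _)

open MulAction in
theorem twentyone_le_of_injective {G : Type*} [Group G] [Finite G] (hG : Nat.card G = 20160)
    (hN : ∀ P : Subgroup G, Nat.card P = 7 → Nat.card (Subgroup.normalizer (P : Set G)) ≤ 21)
    (E : Subgroup G) (hE : Nat.card E = 16) (e₀ : G) (he₀ : e₀ ≠ 1)
    (hconj : ∀ e ∈ E, e ≠ 1 → IsConj e₀ e) {n : ℕ} (φ : G →* Equiv.Perm (Fin n))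
    (hφ : Function.Injective φ) : 21 ≤ n := by
  by_contra! hn
  obtain ⟨ω, hω⟩ : ∃ ω, φ e₀ ω ≠ ω := by
    by_contra! h
    exact he₀ (hφ (by rw [map_one]; exact Equiv.ext h))
  let _ : MulAction G (Fin n) := MulAction.compHom _ φ
  let X := orbit G ω
  have hX : Nat.card X ≤ 20 := by
    refine (Nat.card_le_card_of_injective _ Subtype.val_injective).trans ?_
    simp; omega
  have hconjfix : ∀ g e : G, IsConj g e → Nat.card (fixedBy X e) = Nat.card (fixedBy X g) := by
    intro g e h
    obtain ⟨c, rfl⟩ := isConj_iff.1 h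
    refine Nat.card_congr ((Equiv.subtypeEquiv (MulAction.toPerm c) fun x => ?_).symm)
    simp [mem_fixedBy, mul_smul]
  have hlt : Nat.card (fixedBy X e₀) < Nat.card X := by
    refine lt_of_le_of_ne (Nat.card_le_card_of_injective _ Subtype.val_injective) fun h => ?_
    have := (Nat.bijective_iff_injective_and_card
      (Subtype.val : fixedBy X e₀ → X)).2 ⟨Subtype.val_injective, h⟩
    obtain ⟨⟨y, hy⟩, hyω⟩ := this.2 ⟨ω, mem_orbit_self ω⟩
    subst hyω
    exact hω (congrArg Subtype.val hy)
  have hdvd := card_dvd_sub_card_fixedBy (E := E) (X := X) (Nat.card (fixedBy X e₀))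
    (fun e he => hconjfix e₀ e (hconj e e.2 (by simpa using he))) hlt.le
  have h16 := Nat.le_of_dvd (by omega) hdvd
  rw [hE] at h16
  have hidx : (stabilizer G ω).index = Nat.card X := MulAction.index_stabilizer G ω
  exact index_not_mem_Icc hG hN (stabilizer G ω) (by omega) (by omega)

theorem card_quotient_inner_eq {G P : Type*} [Group G] [Finite G] [Finite P]
    (x t : G) (hgen : Subgroup.closure {x, t} = ⊤)
    (hsyl : ∀ ψ : MulAut G, ∃ g, ψ x = g * x * g⁻¹ ∨ ψ x = g * x⁻¹ * g⁻¹)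
    (hcent : ∀ g, g * x * g⁻¹ = x → ∃ k : ℤ, g = x ^ k)
    (hreal : ∀ g, g * x * g⁻¹ ≠ x⁻¹)
    (α : P → MulAut G) (hα : ∀ p, α p x = x) (σ : MulAut G) (hσ : σ x = x⁻¹)
    (hclass : ∀ ψ : MulAut G, ψ x = x → ∃ p, ∃ k : ℤ, ψ t = x ^ k * α p t * (x ^ k)⁻¹)
    (hdist : ∀ p q, ∀ k : ℤ, x ^ k * α p t * (x ^ k)⁻¹ = α q t → p = q) :
    Nat.card (MulAut G ⧸ (MulAut.conj : G →* MulAut G).range) = Nat.card P * 2 := by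
  have hfix : ∀ ψ : MulAut G, ψ x = x → ∃ p g, ψ = MulAut.conj g * α p := by
    intro ψ hψ
    obtain ⟨p, k, hk⟩ := hclass ψ hψ
    refine ⟨p, x ^ k, MulEquiv.toMonoidHom_injective
      (MonoidHom.eq_of_eqOn_dense hgen ?_)⟩
    rintro z (rfl | rfl)
    · simp only [MulEquiv.toMonoidHom_eq_coe, MonoidHom.coe_coe, MulAut.mul_apply, hα,
        MulAut.conj_apply, hψ]
      rw [← zpow_add_one, add_comm, zpow_one_add, mul_inv_cancel_right]
    · simpa only [MulEquiv.toMonoidHom_eq_coe, MonoidHom.coe_coe, MulAut.mul_apply,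
        MulAut.conj_apply] using hk
  have hcomm : ∀ (ψ : MulAut G) g, ψ * MulAut.conj g = MulAut.conj (ψ g) * ψ := by
    intro ψ g; ext z; simp
  have hinner : ∀ p q g, MulAut.conj g * α p = α q → p = q := by
    intro p q g h
    have h1 := DFunLike.congr_fun h x
    rw [MulAut.mul_apply, hα, hα, MulAut.conj_apply] at h1
    obtain ⟨k, rfl⟩ := hcent g h1
    exact hdist p q k (DFunLike.congr_fun h t)
  let F : P × Bool → MulAut G ⧸ (MulAut.conj : G →* MulAut G).range :=
    fun p => ((α p.1 * bif p.2 then σ else 1 : MulAut G) : MulAut G ⧸ _)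
  have hF : Function.Bijective F := by
    constructor
    · rintro ⟨p, e⟩ ⟨q, f⟩ h
      obtain ⟨g, hg⟩ := QuotientGroup.eq.1 h
      rw [eq_inv_mul_iff_mul_eq, hcomm] at hg
      generalize ((α p * bif e then σ else 1 : MulAut G) g) = g' at hg
      have hgx := DFunLike.congr_fun hg x
      cases e <;> cases f
      · rw [cond_false, mul_one, mul_one] at hg
        exact congrArg (·, _) (hinner _ _ _ hg)
      · simp only [cond_false, cond_true, mul_one, MulAut.mul_apply, hα, hσ, map_inv,
          MulAut.conj_apply] at hgx
        exact absurd hgx (hreal _)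
      · simp only [cond_false, cond_true, mul_one, MulAut.mul_apply, hα, hσ, map_inv,
          MulAut.conj_apply] at hgx
        exact absurd (by rw [← inv_inj, inv_inv]; simpa [mul_assoc] using hgx) (hreal g')
      · rw [cond_true, ← mul_assoc, mul_left_inj] at hg
        exact congrArg (·, _) (hinner _ _ _ hg)
    · intro ψ
      induction ψ using QuotientGroup.induction_on with | H ψ => ?_
      suffices ∃ (p : P × Bool) (g : G), ψ = MulAut.conj g * (α p.1 * bif p.2 then σ else 1) by
        obtain ⟨p, g, rfl⟩ := this
        refine ⟨p, QuotientGroup.eq.2 ?_⟩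
        generalize (α p.1 * bif p.2 then σ else 1) = β
        refine ⟨β⁻¹ g, ?_⟩
        rw [eq_inv_mul_iff_mul_eq, hcomm, MulAut.apply_inv_self]
      obtain ⟨g, hg | hg⟩ := hsyl ψ
      · obtain ⟨p, g', h⟩ := hfix (MulAut.conj g⁻¹ * ψ) (by simp [hg, mul_assoc])
        refine ⟨(p, false), g * g', ?_⟩
        rw [map_mul, mul_assoc, cond_false, mul_one, ← h, ← mul_assoc, ← map_mul]
        simp
      · obtain ⟨p, g', h⟩ := hfix (MulAut.conj g⁻¹ * ψ * σ⁻¹) (by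
          have : σ⁻¹ x = x⁻¹ := by
            rw [← inv_inv (σ⁻¹ x), ← map_inv, ← hσ, MulAut.inv_apply_self, hσ]
          simp [this, hg, mul_assoc])
        refine ⟨(p, true), g * g', ?_⟩
        rw [map_mul, mul_assoc, cond_true, ← mul_assoc (MulAut.conj g'), ← h, ← mul_assoc,
          ← mul_assoc, ← mul_assoc, ← map_mul]
        simp
  rw [← Nat.card_eq_of_bijective F hF, Nat.card_prod]
  simp

/-- Sylow's theorem for an element generating a Sylow `7`-subgroup. -/
theorem exists_map_eq_conj {G : Type*} [Group G] [Finite G] {k : ℕ} (hG : Nat.card G = 7 * k)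
    (hk : ¬ 7 ∣ k) (x y : G) (hx : orderOf x = 7) (hy : y * x * y⁻¹ = x ^ 2) (ψ : MulAut G) :
    ∃ g, ψ x = g * x * g⁻¹ ∨ ψ x = g * x⁻¹ * g⁻¹ := by
  classical
  have : Fact (Nat.Prime 7) := ⟨by norm_num⟩
  have hc : Nat.card (Subgroup.zpowers x) = 7 ^ (Nat.card G).factorization 7 := by
    rw [Nat.card_zpowers, hx, card_sylow_seven_aux hG hk]
  have hc' : Nat.card (Subgroup.zpowers (ψ x)) = 7 ^ (Nat.card G).factorization 7 := by
    rw [← hc, Nat.card_zpowers, Nat.card_zpowers, MulEquiv.orderOf_eq]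
  obtain ⟨g, hg⟩ := MulAction.exists_smul_eq G (Sylow.ofCard _ hc) (Sylow.ofCard _ hc')
  have hmem : ψ x ∈ Sylow.ofCard _ hc' := Subgroup.mem_zpowers (ψ x)
  rw [← hg, ← SetLike.mem_coe, Sylow.coe_smul, Set.mem_smul_set] at hmem
  obtain ⟨z, hz, hzx⟩ := hmem
  have hz' : z ∈ Subgroup.zpowers x := hz
  rw [mem_zpowers_iff_mem_range_orderOf, hx] at hz'
  simp only [Finset.mem_image, Finset.mem_range] at hz'
  obtain ⟨n, hn, rfl⟩ := hz'
  have h7 : x ^ 7 = 1 := hx ▸ pow_orderOf_eq_one x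
  have hy' : y ^ 2 * x * (y ^ 2)⁻¹ = x ^ 4 := by
    calc _ = y * (y * x * y⁻¹) * y⁻¹ := by simp only [sq, mul_inv_rev, mul_assoc]
      _ = (y * x * y⁻¹) ^ 2 := by rw [conj_pow, hy]
      _ = x ^ 4 := by rw [hy, ← pow_mul]
  have key : ∀ h, (x ^ n = h * x * h⁻¹ ∨ x ^ n = h * x⁻¹ * h⁻¹) →
      ∃ g, ψ x = g * x * g⁻¹ ∨ ψ x = g * x⁻¹ * g⁻¹ := by
    intro h hh
    refine ⟨g * h, hh.imp (fun hh => ?_) fun hh => ?_⟩ <;>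
    · rw [← hzx, hh]
      simp [mul_assoc]
  have hinv : ∀ a b, a + b = 7 → x ^ a = (x ^ b)⁻¹ := fun a b hab => by
    rw [eq_inv_iff_mul_eq_one, ← pow_add, hab, h7]
  interval_cases n
  · have : ψ x = 1 := by rw [← hzx]; simp
    rw [EmbeddingLike.map_eq_one_iff] at this
    simp [this] at hx
  · exact key 1 (by simp)
  · exact key y (.inl hy.symm)
  · exact key (y ^ 2) (.inr (by rw [hinv 3 4 rfl, ← hy']; group))
  · exact key (y ^ 2) (.inl hy'.symm)
  · exact key y (.inr (by rw [hinv 5 2 rfl, ← hy]; group))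
  · exact key 1 (.inr (by rw [hinv 6 1 rfl]; simp))

/-- The field with four elements, as an enumerated type: `w` is a primitive cube root of unity and
`v = w + 1` is its square. -/
inductive F4 | z | o | w | v
  deriving DecidableEq

namespace F4

def add (a b : F4) : F4 :=
  F4.casesOn a b (F4.casesOn b o z v w) (F4.casesOn b w v z o) (F4.casesOn b v w o z)

def mul (a b : F4) : F4 :=
  F4.casesOn a z b (F4.casesOn b z w v o) (F4.casesOn b z v o w)

/-- The Frobenius map, which is also the inversion map. -/
def frob : F4 → F4
  | z => z | o => o | w => v | v => w

def beq : F4 → F4 → Bool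
  | z, z => true | o, o => true | w, w => true | v, v => true | _, _ => false

instance : Fintype F4 := ⟨{z, o, w, v}, by rintro (_ | _ | _ | _) <;> simp⟩

theorem card_eq : Fintype.card F4 = 4 := rfl

instance : Zero F4 := ⟨z⟩
instance : One F4 := ⟨o⟩
instance : Add F4 := ⟨add⟩
instance : Neg F4 := ⟨id⟩
instance : Mul F4 := ⟨mul⟩
instance : Inv F4 := ⟨frob⟩

instance : Field F4 where
  add_assoc := by rintro (_ | _ | _ | _) (_ | _ | _ | _) (_ | _ | _ | _) <;> rfl
  zero_add := by rintro (_ | _ | _ | _) <;> rfl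
  add_zero := by rintro (_ | _ | _ | _) <;> rfl
  add_comm := by rintro (_ | _ | _ | _) (_ | _ | _ | _) <;> rfl
  neg_add_cancel := by rintro (_ | _ | _ | _) <;> rfl
  mul_assoc := by rintro (_ | _ | _ | _) (_ | _ | _ | _) (_ | _ | _ | _) <;> rfl
  one_mul := by rintro (_ | _ | _ | _) <;> rfl
  mul_one := by rintro (_ | _ | _ | _) <;> rfl
  mul_comm := by rintro (_ | _ | _ | _) (_ | _ | _ | _) <;> rfl
  left_distrib := by rintro (_ | _ | _ | _) (_ | _ | _ | _) (_ | _ | _ | _) <;> rfl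
  right_distrib := by rintro (_ | _ | _ | _) (_ | _ | _ | _) (_ | _ | _ | _) <;> rfl
  zero_mul := by rintro (_ | _ | _ | _) <;> rfl
  mul_zero := by rintro (_ | _ | _ | _) <;> rfl
  exists_pair_ne := ⟨z, o, by decide⟩
  mul_inv_cancel := by rintro (_ | _ | _ | _) h <;> first | rfl | exact absurd rfl h
  inv_zero := rfl
  nsmul := nsmulRec
  zsmul := zsmulRec
  nnqsmul := _
  qsmul := _

theorem add_eq (a b : F4) : a.add b = a + b := rfl
theorem mul_eq (a b : F4) : a.mul b = a * b := rfl
theorem z_eq : z = 0 := rfl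
theorem o_eq : o = 1 := rfl

theorem beq_iff {a b : F4} : a.beq b = true ↔ a = b := by
  cases a <;> cases b <;> decide

instance : CharP F4 2 := CharTwo.of_one_ne_zero_of_two_eq_zero one_ne_zero rfl

def frobHom : F4 →+* F4 where
  toFun := frob
  map_one' := rfl
  map_mul' := by rintro (_ | _ | _ | _) (_ | _ | _ | _) <;> rfl
  map_zero' := rfl
  map_add' := by rintro (_ | _ | _ | _) (_ | _ | _ | _) <;> rfl

theorem pow_three : ∀ a : F4, a ≠ 0 → a ^ 3 = 1 := by
  rintro (_ | _ | _ | _) h <;> first | rfl | exact absurd rfl h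

/-- Apply a function to the normal form of an element; this makes kernel reduction eager. -/
def force {α : Sort*} (a : F4) (k : F4 → α) : α :=
  F4.casesOn a (k z) (k o) (k w) (k v)

@[simp] theorem force_eq {α : Sort*} (a : F4) (k : F4 → α) : a.force k = k a := by
  cases a <;> rfl

def all (p : F4 → Bool) : Bool := p z && (p o && (p w && p v))

theorem all_iff {p : F4 → Bool} : all p = true ↔ ∀ a, p a = true := by
  simp only [all, Bool.and_eq_true]
  exact ⟨fun h a => by cases a <;> simp [h], fun h => by simp [h]⟩

end F4

/-- A `3 × 3` matrix over `F4`, by rows. -/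
@[ext]
structure M3 where
  (a b c d e f g h i : F4)

namespace M3
open F4

def mat (A : M3) : Matrix (Fin 3) (Fin 3) F4 :=
  !![A.a, A.b, A.c; A.d, A.e, A.f; A.g, A.h, A.i]

def of (M : Matrix (Fin 3) (Fin 3) F4) : M3 :=
  ⟨M 0 0, M 0 1, M 0 2, M 1 0, M 1 1, M 1 2, M 2 0, M 2 1, M 2 2⟩

@[simp] theorem mat_of (M) : (of M).mat = M := (Matrix.eta_fin_three M).symm
@[simp] theorem of_mat (A : M3) : of A.mat = A := rfl

theorem mat_injective : Function.Injective mat := Function.LeftInverse.injective of_mat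

def dot (a b c p q r : F4) : F4 := (a.mul p).add ((b.mul q).add (c.mul r))

/-- Normalize all entries. -/
def eval {α : Sort*} (A : M3) (k : M3 → α) : α :=
  A.a.force fun a => A.b.force fun b => A.c.force fun c =>
  A.d.force fun d => A.e.force fun e => A.f.force fun f =>
  A.g.force fun g => A.h.force fun h => A.i.force fun i => k ⟨a, b, c, d, e, f, g, h, i⟩

@[simp] theorem eval_eq {α : Sort*} (A : M3) (k : M3 → α) : A.eval k = k A := by simp [eval]

def mul (A B : M3) : M3 :=
  eval
    ⟨dot A.a A.b A.c B.a B.d B.g, dot A.a A.b A.c B.b B.e B.h, dot A.a A.b A.c B.c B.f B.i,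
      dot A.d A.e A.f B.a B.d B.g, dot A.d A.e A.f B.b B.e B.h, dot A.d A.e A.f B.c B.f B.i,
      dot A.g A.h A.i B.a B.d B.g, dot A.g A.h A.i B.b B.e B.h, dot A.g A.h A.i B.c B.f B.i⟩ id

theorem mat_mul (A B : M3) : (A.mul B).mat = A.mat * B.mat := by
  simp [mul, mat, dot, add_eq, mul_eq]

def one : M3 := ⟨o, z, z, z, o, z, z, z, o⟩

theorem mat_one : one.mat = 1 := Matrix.one_fin_three.symm

def pow (A : M3) : ℕ → M3
  | 0 => one
  | n + 1 => (A.pow n).mul A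

theorem mat_pow (A : M3) (n : ℕ) : (A.pow n).mat = A.mat ^ n := by
  induction n with
  | zero => exact mat_one
  | succ n ih => rw [pow, mat_mul, ih, pow_succ]

def smul (r : F4) (A : M3) : M3 :=
  eval ⟨r.mul A.a, r.mul A.b, r.mul A.c, r.mul A.d, r.mul A.e, r.mul A.f,
    r.mul A.g, r.mul A.h, r.mul A.i⟩ id

theorem mat_smul (r : F4) (A : M3) : (A.smul r).mat = r • A.mat := by
  simp [smul, mat, mul_eq, Matrix.smul_of]

def det (A : M3) : F4 :=
  (A.a.mul ((A.e.mul A.i).add (A.f.mul A.h))).add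
    ((A.b.mul ((A.d.mul A.i).add (A.f.mul A.g))).add
      (A.c.mul ((A.d.mul A.h).add (A.e.mul A.g))))

theorem det_mat (A : M3) : A.mat.det = A.det := by
  simp only [mat, Matrix.det_fin_three, det, add_eq, mul_eq, CharTwo.sub_eq_add]
  simp
  ring

def transpose (A : M3) : M3 := ⟨A.a, A.d, A.g, A.b, A.e, A.h, A.c, A.f, A.i⟩

theorem mat_transpose (A : M3) : A.transpose.mat = A.mat.transpose := by
  ext i j; fin_cases i <;> fin_cases j <;> rfl

def frob (A : M3) : M3 :=
  ⟨A.a.frob, A.b.frob, A.c.frob, A.d.frob, A.e.frob, A.f.frob, A.g.frob, A.h.frob, A.i.frob⟩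

theorem mat_frob (A : M3) : A.frob.mat = A.mat.map F4.frobHom := by
  ext i j; fin_cases i <;> fin_cases j <;> rfl

def beq (A B : M3) : Bool :=
  A.a.beq B.a && (A.b.beq B.b && (A.c.beq B.c && (A.d.beq B.d && (A.e.beq B.e &&
    (A.f.beq B.f && (A.g.beq B.g && (A.h.beq B.h && A.i.beq B.i)))))))

theorem beq_iff {A B : M3} : A.beq B = true ↔ A = B := by
  simp [beq, M3.ext_iff, F4.beq_iff]

/-- Equality up to a nonzero scalar. -/
def eqv (A B : M3) : Bool := A.beq B || (A.beq (B.smul w) || A.beq (B.smul v))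

theorem eqv_iff {A B : M3} : A.eqv B = true ↔ ∃ r : F4, r ≠ 0 ∧ A.mat = r • B.mat := by
  simp only [eqv, Bool.or_eq_true, beq_iff, ← mat_smul, mat_injective.eq_iff]
  constructor
  · rintro (h | h | h)
    · exact ⟨o, by decide, by rw [h]; simp [smul]; rfl⟩
    · exact ⟨w, by decide, h⟩
    · exact ⟨v, by decide, h⟩
  · rintro ⟨_ | _ | _ | _, h, h'⟩
    · exact absurd rfl h
    · left; rw [h']; simp [smul]; rfl
    · exact .inr (.inl h')
    · exact .inr (.inr h')

/-- An element of order `7`. -/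
def X : M3 := ⟨z, o, z, o, z, o, z, o, o⟩
/-- The inverse of `X`. -/
def X' : M3 := ⟨o, o, o, o, z, z, o, z, o⟩
/-- An element conjugating `X` to `X ^ 2`. -/
def Y : M3 := ⟨z, z, o, o, z, z, z, o, z⟩
/-- An element of determinant `v` commuting with `X`. -/
def C : M3 := ⟨w, w, v, w, o, o, v, o, v⟩
/-- The inverse of `C`. -/
def C' : M3 := ⟨v, v, w, v, o, o, w, o, w⟩

/-- An involution and its transforms under six automorphisms fixing `X`. -/
def T : Fin 3 → Fin 2 → M3
  | 0, 0 => ⟨z, z, w, v, o, o, v, z, z⟩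
  | 0, 1 => ⟨z, z, v, w, o, o, w, z, z⟩
  | 1, 0 => ⟨o, o, o, z, v, w, z, w, v⟩
  | 1, 1 => ⟨o, z, z, v, o, o, z, z, o⟩
  | 2, 0 => ⟨o, z, z, w, o, o, z, z, o⟩
  | 2, 1 => ⟨o, o, o, z, w, v, z, v, w⟩

theorem T_succ (j : Fin 2) :
    ((C.mul (T 0 j)).mul C').eqv (T 1 j) = true ∧ ((C.mul (T 1 j)).mul C').eqv (T 2 j) = true := by
  decide +kernel +revert

theorem T_conj_distinct : ∀ i i' j j', ∀ k : Fin 7,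
    (((X.pow k).mul (T i j)).eqv ((T i' j').mul (X.pow k))) = true → (i, j) = (i', j') := by
  decide +kernel

/-- The matrix with first column `(a, d, g)` which solves `A * X = M * A`, if any. -/
def ofCol (M : M3) (a d g : F4) : M3 :=
  eval ⟨a, dot M.a M.b M.c a d g, z, d, dot M.d M.e M.f a d g, z,
    g, dot M.g M.h M.i a d g, z⟩ fun B =>
  eval ⟨a, B.b, (dot M.a M.b M.c B.b B.e B.h).add a, d, B.e, (dot M.d M.e M.f B.b B.e B.h).add d,
    g, B.h, (dot M.g M.h M.i B.b B.e B.h).add g⟩ id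

theorem eq_ofCol {A M : M3} (h : A.mul X = M.mul A) : A = ofCol M A.a A.d A.g := by
  obtain ⟨a, b, c, d, e, f, g, h, i⟩ := A
  simp only [mul, X, eval_eq, id_eq, dot, M3.mk.injEq, add_eq, mul_eq, z_eq, o_eq, mul_zero,
    mul_one, zero_add, add_zero] at h
  obtain ⟨h1, h2, -, h4, h5, -, h7, h8, -⟩ := h
  simp only [ofCol, eval_eq, id_eq, dot, add_eq, mul_eq, ← h1, ← h2, ← h4, ← h5, ← h7, ← h8]
  simp only [add_right_comm _ _ a, add_right_comm _ _ d, add_right_comm _ _ g,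
    CharTwo.add_self_eq_zero, zero_add]

/-- Solutions `A` of `A * X = r X ^ k A` of determinant one are products of powers of `X` and `Y`. -/
theorem normalizer_check : (F4.all fun r => F4.all fun a => F4.all fun d => F4.all fun g =>
    (List.range 7).all fun k => ((X.pow k).smul r).eval fun M => (ofCol M a d g).eval fun A =>
    !(A.det.beq o && (A.mul X).beq (M.mul A)) ||
      (List.range 7).any fun m => (List.range 3).any fun n =>
        A.eqv ((X.pow m).mul (Y.pow n))) = true := by
  decide +kernel

/-- The transvection `1 + u pᵀ`. -/
def transl (u₁ u₂ u₃ p₁ p₂ p₃ : F4) : M3 :=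
  eval ⟨o.add (u₁.mul p₁), u₁.mul p₂, u₁.mul p₃, u₂.mul p₁, o.add (u₂.mul p₂), u₂.mul p₃,
    u₃.mul p₁, u₃.mul p₂, o.add (u₃.mul p₃)⟩ id

/-- `X V X V X³ V`. -/
def relWord (V : M3) : M3 :=
  ((((X.mul V).mul X).mul V).mul (X.pow 3)).mul V

/-- The cube of `X V X V X³ V` is a scalar. -/
def rel (V : M3) : Bool := ((relWord V).pow 3).eqv one

/-- Search for a conjugate of `V` under a power of `X` among the matrices `T i j`. -/
def search : ℕ → M3 → Bool
  | 0, _ => false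
  | n + 1, V =>
    (V.eqv (T 0 0) || (V.eqv (T 0 1) || (V.eqv (T 1 0) || (V.eqv (T 1 1) ||
      (V.eqv (T 2 0) || V.eqv (T 2 1)))))) || search n ((X'.mul V).mul X)

/-- Up to conjugation by powers of `X`, the matrices `T i j` are the only involutions satisfying
the relation `rel`. -/
theorem search_transl : ((fun p : F4 → F4 → F4 → Bool =>
      (F4.all fun a => F4.all fun b => p o a b) && (F4.all fun b => p z o b) && p z z o)
    fun u₁ u₂ u₃ => F4.all fun p₁ => F4.all fun p₂ => F4.all fun p₃ =>
    !(dot u₁ u₂ u₃ p₁ p₂ p₃).beq z || ((transl u₁ u₂ u₃ p₁ p₂ p₃).beq one ||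
      (!rel (transl u₁ u₂ u₃ p₁ p₂ p₃) || search 7 (transl u₁ u₂ u₃ p₁ p₂ p₃)))) = true := by
  decide +kernel

theorem relWord_T : rel (T 0 0) = true := by decide +kernel

/-- The product `X ^ k₀ * T * X ^ k₁ * T * ⋯ * X ^ kₙ`, where `T = T 0 0`. -/
def ofWord : List ℕ → M3
  | [] => one
  | [k] => X.pow k
  | k :: l => ((X.pow k).mul (T 0 0)).mul (ofWord l)

def word : Fin 3 → Fin 3 → F4 → List ℕ
  | 0, 1, o => [4, 3, 1, 1, 2, 1, 2]
  | 0, 1, w => [6, 1, 1, 2, 2]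
  | 0, 1, v => [6, 1, 3, 1, 4]
  | 0, 2, o => [3, 1, 2, 3, 2, 1, 3]
  | 0, 2, w => [0, 4, 1, 2, 1, 4, 0]
  | 0, 2, v => [4, 1, 3, 2, 2, 1, 0]
  | 1, 0, o => [0, 1, 2, 5, 2]
  | 1, 0, w => [0, 1, 1, 2, 1]
  | 1, 0, v => [0, 1, 3, 1, 3]
  | 1, 2, o => [1, 3, 1, 3, 0]
  | 1, 2, w => [1, 2, 5, 2, 0]
  | 1, 2, v => [1, 1, 2, 1, 0]
  | 2, 0, o => [6, 1, 2, 3, 2, 1, 0]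
  | 2, 0, w => [0, 1, 4, 2, 5, 2, 0]
  | 2, 0, v => [0, 2, 2, 1, 2, 2, 1]
  | 2, 1, o => [3, 3, 1, 3, 5]
  | 2, 1, w => [1, 2, 5, 2, 3, 0]
  | 2, 1, v => [3, 1, 2, 1, 5]
  | _, _, _ => []

theorem ofWord_word : ∀ i j, i ≠ j → ∀ c,
    (ofWord (word i j c)).eqv (of (Matrix.transvection i j c)) = true := by
  decide +kernel

def diagWord (i j : Fin 3) (c : F4) : List ℕ :=
  if c = o then [] else if (c = w) = (j = i + 1) then [3, 2, 4, 2, 0] else [2, 4, 2, 1, 2, 1, 1, 0]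

theorem ofWord_diagWord : ∀ i j, i ≠ j → ∀ c, c ≠ 0 →
    (ofWord (diagWord i j c)).eqv (of (Matrix.diagonal fun k ↦
      if k = i then c else if k = j then c⁻¹ else 1)) = true := by
  decide +kernel

def root (a b : F4) : M3 := ⟨o, z, a, z, o, b, z, z, o⟩

/-- A matrix of determinant one whose conjugation action takes `root o z` to `root a b`. -/
def rootConj (a b : F4) : M3 :=
  if a = z then ⟨z, b.frob, z, b, z, z, z, z, o⟩ else ⟨a, z, z, b, a.frob, z, z, z, o⟩

theorem root_conj : ∀ a b, (a, b) ≠ 0 → (rootConj a b).det = o ∧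
    (rootConj a b).mul (root o z) = (root a b).mul (rootConj a b) := by
  simp only [← beq_iff]
  decide +kernel

end M3

/-- `SL(3,4)` over the enumerated field. -/
abbrev SL4 : Type := Matrix.SpecialLinearGroup (Fin 3) F4

/-- `PSL(3,4)` over the enumerated field. -/
abbrev G4 : Type := Matrix.ProjectiveSpecialLinearGroup (Fin 3) F4

namespace G4
open Matrix

theorem mk_eq_mk {S S' : SL4} :
    (S : G4) = S' ↔ ∃ r : F4, r ≠ 0 ∧ (S : Matrix (Fin 3) (Fin 3) F4) = r • ↑S' := by
  rw [eq_comm, QuotientGroup.eq, Matrix.SpecialLinearGroup.mem_center_iff]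
  constructor
  · rintro ⟨r, hr, h⟩
    refine ⟨r, fun h0 => by simp [h0] at hr, ?_⟩
    calc (S : Matrix (Fin 3) (Fin 3) F4) = ↑(S' * (S'⁻¹ * S)) := by rw [mul_inv_cancel_left]
      _ = r • ↑S' := by
        rw [Matrix.SpecialLinearGroup.coe_mul, ← h, scalar_apply, ← smul_one_eq_diagonal,
          mul_smul_comm, mul_one]
  · rintro ⟨r, hr, h⟩
    refine ⟨r, F4.pow_three r hr, ?_⟩
    rw [Matrix.SpecialLinearGroup.coe_mul, h, mul_smul_comm, ← Matrix.SpecialLinearGroup.coe_mul,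
      inv_mul_cancel, Matrix.SpecialLinearGroup.coe_one, smul_one_eq_diagonal, scalar_apply]

/-- The matrix `A` has determinant one and represents `g`. -/
def Rep (g : G4) (A : M3) : Prop :=
  ∃ S : SL4, (S : G4) = g ∧ (S : Matrix (Fin 3) (Fin 3) F4) = A.mat

theorem exists_rep (g : G4) : ∃ A, Rep g A := by
  obtain ⟨S, rfl⟩ := QuotientGroup.mk_surjective g
  exact ⟨M3.of S, S, rfl, by simp⟩

theorem exists_of_det {A : M3} (h : A.det = 1) : ∃ g, Rep g A :=
  ⟨_, ⟨A.mat, by rw [A.det_mat, h]⟩, rfl, rfl⟩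

namespace Rep
variable {g g' : G4} {A B : M3}

theorem det (h : Rep g A) : A.det = 1 := by
  obtain ⟨S, -, hS⟩ := h
  rw [← A.det_mat, ← hS, S.det_coe]

theorem mul (h : Rep g A) (h' : Rep g' B) : Rep (g * g') (A.mul B) := by
  obtain ⟨S, rfl, hS⟩ := h
  obtain ⟨S', rfl, hS'⟩ := h'
  exact ⟨S * S', rfl, by rw [M3.mat_mul, Matrix.SpecialLinearGroup.coe_mul, hS, hS']⟩

theorem one : Rep 1 M3.one := ⟨1, rfl, M3.mat_one.symm⟩

theorem pow (h : Rep g A) (n : ℕ) : Rep (g ^ n) (A.pow n) := by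
  induction n with
  | zero => rw [pow_zero]; exact one
  | succ n ih => exact pow_succ g n ▸ ih.mul h

theorem smul (h : Rep g A) {r : F4} (hr : r ≠ 0) : Rep g (A.smul r) := by
  obtain ⟨S, rfl, hS⟩ := h
  refine ⟨⟨r • ↑S, by simp [F4.pow_three r hr]⟩, mk_eq_mk.2 ⟨r, hr, rfl⟩, ?_⟩
  rw [M3.mat_smul, ← hS]

theorem eqv_iff (h : Rep g A) (h' : Rep g' B) : A.eqv B = true ↔ g = g' := by
  obtain ⟨S, rfl, hS⟩ := h
  obtain ⟨S', rfl, hS'⟩ := h'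
  rw [M3.eqv_iff, mk_eq_mk, hS, hS']

theorem ext (h : Rep g A) (h' : Rep g' A) : g = g' := by
  obtain ⟨S, rfl, hS⟩ := h
  obtain ⟨S', rfl, hS'⟩ := h'
  rw [Subtype.ext (hS.trans hS'.symm)]

theorem of_eqv (h : Rep g A) (hB : B.det = 1) (hAB : A.eqv B = true) : Rep g B := by
  obtain ⟨g', h'⟩ := exists_of_det hB
  rwa [(h.eqv_iff h').1 hAB]

end Rep

/-- The automorphism induced by an automorphism of the special linear group. -/
def liftAut (e : SL4 ≃* SL4) : MulAut G4 :=
  QuotientGroup.congr _ _ e (Subgroup.characteristic_iff_map_eq.1 inferInstance e)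

/-- The automorphism induced by the Frobenius map. -/
def frobAut : MulAut G4 :=
  liftAut
    { Matrix.SpecialLinearGroup.map F4.frobHom with
      invFun := Matrix.SpecialLinearGroup.map F4.frobHom
      left_inv := fun S => by
        ext i j
        change (S i j).frob.frob = S i j
        cases S i j <;> rfl
      right_inv := fun S => by
        ext i j
        change (S i j).frob.frob = S i j
        cases S i j <;> rfl }

theorem mat_C'_mul_mat_C : M3.C'.mat * M3.C.mat = 1 := by
  rw [← M3.mat_mul, ← M3.mat_one]; rfl

theorem mat_C_mul_mat_C' : M3.C.mat * M3.C'.mat = 1 := mul_eq_one_comm.1 mat_C'_mul_mat_C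

/-- Conjugation of the special linear group by an invertible matrix. -/
def conjSL {P Q : Matrix (Fin 3) (Fin 3) F4} (h : P * Q = 1) (h' : Q * P = 1) : SL4 ≃* SL4 where
  toFun S := ⟨P * ↑S * Q, by rw [det_mul, det_mul, S.det_coe, mul_one, ← det_mul, h, det_one]⟩
  invFun S := ⟨Q * ↑S * P, by rw [det_mul, det_mul, S.det_coe, mul_one, ← det_mul, h', det_one]⟩
  map_mul' S S' := Subtype.ext <| by
    change P * ((S : Matrix (Fin 3) (Fin 3) F4) * (S' : Matrix (Fin 3) (Fin 3) F4)) * Q =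
      (P * (S : Matrix (Fin 3) (Fin 3) F4) * Q) * (P * (S' : Matrix (Fin 3) (Fin 3) F4) * Q)
    simp only [mul_assoc]
    rw [← mul_assoc Q P, h', one_mul]
  left_inv S := Subtype.ext <| by
    change Q * (P * (S : Matrix (Fin 3) (Fin 3) F4) * Q) * P = (S : Matrix (Fin 3) (Fin 3) F4)
    simp only [mul_assoc]
    rw [h', mul_one, ← mul_assoc, h', one_mul]
  right_inv S := Subtype.ext <| by
    change P * (Q * (S : Matrix (Fin 3) (Fin 3) F4) * P) * Q = (S : Matrix (Fin 3) (Fin 3) F4)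
    simp only [mul_assoc]
    rw [h, mul_one, ← mul_assoc, h, one_mul]

/-- The automorphism induced by conjugation with `C`. -/
def diagAut : MulAut G4 :=
  liftAut (conjSL mat_C_mul_mat_C' mat_C'_mul_mat_C)

theorem transpose_inv (S : SL4) : (S⁻¹).transpose = S.transpose⁻¹ :=
  Subtype.ext (adjugate_transpose (S : Matrix (Fin 3) (Fin 3) F4))

/-- The inverse transpose automorphism. -/
def dualAut : MulAut G4 :=
  liftAut
    { toFun := fun S => S.transpose⁻¹
      invFun := fun S => S.transpose⁻¹
      map_mul' := fun S S' => by
        rw [← _root_.mul_inv_rev, _root_.inv_inj]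
        exact Subtype.ext (transpose_mul _ _)
      left_inv := fun S => by
        dsimp only
        rw [transpose_inv, inv_inv]
        rfl
      right_inv := fun S => by
        dsimp only
        rw [transpose_inv, inv_inv]
        rfl }

theorem Rep.frobAut {g : G4} {A : M3} (h : Rep g A) : Rep (frobAut g) A.frob := by
  obtain ⟨S, rfl, hS⟩ := h
  exact ⟨Matrix.SpecialLinearGroup.map F4.frobHom S, rfl, by rw [M3.mat_frob, ← hS]; rfl⟩

theorem Rep.diagAut {g : G4} {A : M3} (h : Rep g A) :
    Rep (diagAut g) ((M3.C.mul A).mul M3.C') := by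
  obtain ⟨S, rfl, hS⟩ := h
  exact ⟨conjSL mat_C_mul_mat_C' mat_C'_mul_mat_C S, rfl, by
    rw [M3.mat_mul, M3.mat_mul, ← hS]; rfl⟩

theorem Rep.dualAut {g : G4} {A : M3} (h : Rep g A) : Rep (dualAut g)⁻¹ A.transpose := by
  obtain ⟨S, rfl, hS⟩ := h
  refine ⟨S.transpose, ?_, by rw [M3.mat_transpose, ← hS]; rfl⟩
  exact (inv_inv ((S.transpose : SL4) : G4)).symm

theorem card_SL4 : Nat.card SL4 = 60480 := by
  have hGL : Nat.card (GL (Fin 3) F4) = 181440 := by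
    rw [Matrix.card_GL_field, F4.card_eq]
    simp [Fin.prod_univ_three]
  have h := (GeneralLinearGroup.det (n := Fin 3) (R := F4)).ker.card_mul_index
  rw [Subgroup.index_ker, MonoidHom.range_eq_top.2 GeneralLinearGroup.det_surjective,
    Subgroup.card_top, Nat.card_eq_fintype_card (α := F4ˣ), Fintype.card_units, F4.card_eq, hGL] at h
  have hSL : Nat.card SL4 = Nat.card (GeneralLinearGroup.det (n := Fin 3) (R := F4)).ker := by
    refine Nat.card_eq_of_bijective
      (fun S => (⟨(S : GL (Fin 3) F4), by
        rw [MonoidHom.mem_ker]; ext; simp⟩ :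
        (GeneralLinearGroup.det (n := Fin 3) (R := F4)).ker)) ⟨fun S S' h => ?_, fun A => ?_⟩
    · simpa using h
    · refine ⟨⟨A.1, ?_⟩, ?_⟩
      · simpa using congrArg Units.val (MonoidHom.mem_ker.1 A.2)
      · ext; rfl
  omega

theorem card_eq : Nat.card G4 = 20160 := by
  have hprim : IsPrimitiveRoot F4.w 3 := by
    refine IsPrimitiveRoot.mk_of_lt _ (by norm_num) rfl fun l h h' => ?_
    interval_cases l <;> decide
  have h := (Subgroup.center SL4).card_mul_index
  rw [Nat.card_congr (Matrix.SpecialLinearGroup.center_equiv_rootsOfUnity' (0 : Fin 3)).toEquiv,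
    Fintype.card_fin, hprim.card_rootsOfUnity, card_SL4] at h
  change 3 * Nat.card G4 = _ at h
  omega

instance : Finite G4 := Nat.finite_of_card_ne_zero (by rw [card_eq]; norm_num)

/-- The element represented by a matrix of determinant one. -/
def ofM3 (A : M3) (h : A.det = 1) : G4 :=
  QuotientGroup.mk (⟨A.mat, by rw [A.det_mat, h]⟩ : SL4)

theorem rep_ofM3 (A : M3) (h : A.det = 1) : Rep (ofM3 A h) A := ⟨_, rfl, rfl⟩

def x : G4 := ofM3 M3.X rfl
def y : G4 := ofM3 M3.Y rfl
def t : G4 := ofM3 (M3.T 0 0) rfl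

theorem rep_x : Rep x M3.X := rep_ofM3 _ _
theorem rep_y : Rep y M3.Y := rep_ofM3 _ _
theorem rep_t : Rep t (M3.T 0 0) := rep_ofM3 _ _

theorem orderOf_x : orderOf x = 7 := by
  have : Fact (Nat.Prime 7) := ⟨by norm_num⟩
  refine orderOf_eq_prime (((rep_x.pow 7).eqv_iff Rep.one).1 (by decide +kernel)) fun h => ?_
  exact absurd ((rep_x.eqv_iff Rep.one).2 h) (by decide +kernel)

theorem y_conj_x : y * x * y⁻¹ = x ^ 2 := by
  rw [mul_inv_eq_iff_eq_mul]
  exact ((rep_y.mul rep_x).eqv_iff ((rep_x.pow 2).mul rep_y)).1 (by decide +kernel)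

theorem exists_zpow_eq_pow (k : ℤ) : ∃ m < 7, x ^ k = x ^ m := by
  refine ⟨(k % 7).toNat, by omega, ?_⟩
  rw [← zpow_natCast, Int.toNat_of_nonneg (by omega), ← zpow_mod_orderOf, orderOf_x]
  rfl

theorem exists_eq_of_conj_mem {g : G4} {k : ℤ} (h : g * x * g⁻¹ = x ^ k) :
    ∃ m < 7, ∃ n < 3, g = x ^ m * y ^ n := by
  obtain ⟨l, hl, hkl⟩ := exists_zpow_eq_pow k
  rw [hkl, mul_inv_eq_iff_eq_mul] at h
  obtain ⟨A, hA⟩ := exists_rep g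
  obtain ⟨r, hr, hM⟩ :=
    M3.eqv_iff.1 (((hA.mul rep_x).eqv_iff ((rep_x.pow l).mul hA)).2 h)
  have hAX : A.mul M3.X = ((M3.X.pow l).smul r).mul A := by
    apply M3.mat_injective
    rw [hM, M3.mat_mul, M3.mat_mul, M3.mat_smul, smul_mul_assoc]
  have hcol := M3.eq_ofCol hAX
  have hcheck := M3.normalizer_check
  simp only [F4.all_iff, List.all_eq_true, M3.eval_eq] at hcheck
  have := hcheck r A.a A.d A.g l (by simpa using hl)
  rw [← hcol, M3.beq_iff.2 hAX, F4.beq_iff.2 (hA.det.trans F4.o_eq.symm)] at this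
  simp only [Bool.and_self, Bool.not_true, Bool.false_or, List.any_eq_true, List.mem_range] at this
  obtain ⟨m, hm, n, hn, hmn⟩ := this
  exact ⟨m, hm, n, hn, (hA.eqv_iff ((rep_x.pow m).mul (rep_y.pow n))).1 hmn⟩

theorem conj_y_pow {m n : ℕ} (hn : n < 3) :
    x ^ m * y ^ n * x * (x ^ m * y ^ n)⁻¹ = x ^ 2 ^ n := by
  have h : y ^ n * x * (y ^ n)⁻¹ = x ^ 2 ^ n := by
    rw [mul_inv_eq_iff_eq_mul]
    refine (((rep_y.pow n).mul rep_x).eqv_iff ((rep_x.pow (2 ^ n)).mul (rep_y.pow n))).1 ?_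
    interval_cases n <;> decide +kernel
  calc _ = x ^ m * (y ^ n * x * (y ^ n)⁻¹) * (x ^ m)⁻¹ := by group
    _ = x ^ 2 ^ n := by rw [h, ← pow_add, add_comm, pow_add, mul_inv_cancel_right]

theorem eq_zpow_of_conj_eq {g : G4} (h : g * x * g⁻¹ = x) : ∃ k : ℤ, g = x ^ k := by
  obtain ⟨m, hm, n, hn, rfl⟩ := exists_eq_of_conj_mem (k := 1) (by rw [h, zpow_one])
  rw [conj_y_pow hn] at h
  obtain rfl : n = 0 := by
    have h' : x ^ 2 ^ n = x ^ 1 := by rw [h, pow_one]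
    rw [pow_inj_mod, orderOf_x] at h'
    interval_cases n <;> simp_all
  exact ⟨m, by simp⟩

theorem conj_ne_inv (g : G4) : g * x * g⁻¹ ≠ x⁻¹ := by
  intro h
  obtain ⟨m, hm, n, hn, rfl⟩ := exists_eq_of_conj_mem (k := -1) (by rw [h, _root_.zpow_neg_one])
  rw [conj_y_pow hn, eq_inv_iff_mul_eq_one, ← pow_succ, ← orderOf_dvd_iff_pow_eq_one,
    orderOf_x] at h
  interval_cases n <;> omega

theorem card_normalizer_le (P : Subgroup G4) (hP : Nat.card P = 7) :
    Nat.card (Subgroup.normalizer (P : Set G4)) ≤ 21 := by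
  have : Fact (Nat.Prime 7) := ⟨by norm_num⟩
  have hS : 7 ^ (Nat.card G4).factorization 7 = 7 :=
    card_sylow_seven_aux (k := 2880) (by rw [card_eq]) (by norm_num)
  let P₁ : Sylow 7 G4 := Sylow.ofCard P (by rw [hP, hS])
  let P₂ : Sylow 7 G4 := Sylow.ofCard (Subgroup.zpowers x) (by
    rw [Nat.card_zpowers, orderOf_x, hS])
  obtain ⟨g, hg⟩ := MulAction.exists_smul_eq G4 P₂ P₁
  have hg' : P = (Subgroup.zpowers x).map (MulAut.conj g).toMonoidHom :=
    (congrArg (fun Q : Sylow 7 G4 => (Q : Subgroup G4)) hg).symm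
  have hmem (h : G4) : h ∈ P ↔ g⁻¹ * h * g ∈ Subgroup.zpowers x := by
    rw [hg', Subgroup.mem_map]
    constructor
    · rintro ⟨a, ha, rfl⟩
      simpa [mul_assoc] using ha
    · exact fun ha => ⟨_, ha, by simp [mul_assoc]⟩
  have hle : (Subgroup.normalizer (P : Set G4) : Set G4) ⊆
      Set.range fun p : Fin 7 × Fin 3 => g * (x ^ (p.1 : ℕ) * y ^ (p.2 : ℕ)) * g⁻¹ := by
    intro h hh
    have := (Subgroup.mem_normalizer_iff.1 hh (g * x * g⁻¹)).1
      ((hmem _).2 (by simp [mul_assoc]))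
    obtain ⟨k, hk⟩ := Subgroup.mem_zpowers_iff.1 ((hmem _).1 this)
    obtain ⟨m, hm, n, hn, hmn⟩ := exists_eq_of_conj_mem (g := g⁻¹ * h * g) (k := k) (by
      rw [hk]; group)
    exact ⟨(⟨m, hm⟩, ⟨n, hn⟩), by dsimp only; rw [← hmn]; group⟩
  calc _ ≤ Nat.card (Set.range fun p : Fin 7 × Fin 3 =>
        g * (x ^ (p.1 : ℕ) * y ^ (p.2 : ℕ)) * g⁻¹) := Nat.card_mono (Set.toFinite _) hle
    _ ≤ Nat.card (Fin 7 × Fin 3) := Finite.card_range_le _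
    _ = 21 := by simp

/-- The outer automorphisms fixing `x`. -/
def fixAut (p : Fin 3 × Fin 2) : MulAut G4 := diagAut ^ (p.1 : ℕ) * frobAut ^ (p.2 : ℕ)

theorem diagAut_x : diagAut x = x := (rep_x.diagAut.eqv_iff rep_x).1 (by decide +kernel)

theorem frobAut_x : frobAut x = x := (rep_x.frobAut.eqv_iff rep_x).1 (by decide +kernel)

theorem dualAut_x : dualAut x = x⁻¹ :=
  inv_eq_iff_eq_inv.1 ((rep_x.dualAut.eqv_iff rep_x).1 (by decide +kernel))

theorem fixAut_x (p : Fin 3 × Fin 2) : fixAut p x = x := by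
  have hd : ∀ n : ℕ, (diagAut ^ n) x = x := fun n => by
    induction n with
    | zero => rfl
    | succ n ih => rw [pow_succ, MulAut.mul_apply, diagAut_x, ih]
  obtain ⟨i, j⟩ := p
  rw [fixAut, MulAut.mul_apply]
  fin_cases j
  · exact hd i
  · rw [show frobAut ^ 1 = frobAut from pow_one _, frobAut_x, hd]

theorem rep_fixAut_t (p : Fin 3 × Fin 2) : Rep (fixAut p t) (M3.T p.1 p.2) := by
  have hT : ∀ i j, (M3.T i j).det = 1 := by decide +kernel
  have h0 (j : Fin 2) : Rep ((frobAut ^ (j : ℕ)) t) (M3.T 0 j) := by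
    fin_cases j
    · exact rep_t
    · exact rep_t.frobAut
  have h1 (j : Fin 2) := (h0 j).diagAut.of_eqv (hT 1 j) (M3.T_succ j).1
  have h2 (j : Fin 2) := (h1 j).diagAut.of_eqv (hT 2 j) (M3.T_succ j).2
  obtain ⟨i, j⟩ := p
  fin_cases i
  · exact h0 j
  · exact h1 j
  · exact h2 j

theorem conj_fixAut_t_injective (p q : Fin 3 × Fin 2) (k : ℤ)
    (h : x ^ k * fixAut p t * (x ^ k)⁻¹ = fixAut q t) : p = q := by
  obtain ⟨m, hm, hk⟩ := exists_zpow_eq_pow k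
  rw [hk, mul_inv_eq_iff_eq_mul] at h
  exact M3.T_conj_distinct p.1 q.1 p.2 q.2 ⟨m, hm⟩
    ((((rep_x.pow m).mul (rep_fixAut_t p)).eqv_iff ((rep_fixAut_t q).mul (rep_x.pow m))).2 h)

theorem exists_conj_of_search {n : ℕ} {V : M3} {g : G4} (hg : Rep g V)
    (h : M3.search n V = true) : ∃ p, ∃ k : ℤ, g = x ^ k * fixAut p t * (x ^ k)⁻¹ := by
  induction n generalizing V g with
  | zero => simp [M3.search] at h
  | succ n ih =>
    rw [M3.search, Bool.or_eq_true] at h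
    obtain h | h := h
    · obtain ⟨p, hp⟩ : ∃ p : Fin 3 × Fin 2, V.eqv (M3.T p.1 p.2) = true := by
        simp only [Bool.or_eq_true] at h
        obtain h | h | h | h | h | h := h
        exacts [⟨(0, 0), h⟩, ⟨(0, 1), h⟩, ⟨(1, 0), h⟩, ⟨(1, 1), h⟩, ⟨(2, 0), h⟩, ⟨(2, 1), h⟩]
      exact ⟨p, 0, by simpa using (hg.eqv_iff (rep_fixAut_t p)).1 hp⟩
    · have hx' : Rep x⁻¹ M3.X' := by
        have h' := rep_ofM3 M3.X' rfl
        convert h'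
        rw [inv_eq_iff_mul_eq_one]
        exact ((rep_x.mul h').eqv_iff Rep.one).1 (by decide +kernel)
      obtain ⟨p, k, hk⟩ := ih ((hx'.mul hg).mul rep_x) h
      refine ⟨p, k + 1, ?_⟩
      rw [mul_assoc, inv_mul_eq_iff_eq_mul, ← eq_mul_inv_iff_mul_eq] at hk
      rw [hk]
      group

theorem mat_transl (u p : Fin 3 → F4) :
    (M3.transl (u 0) (u 1) (u 2) (p 0) (p 1) (p 2)).mat = 1 + vecMulVec u p := by
  ext i j
  fin_cases i <;> fin_cases j <;>
    simp [M3.transl, M3.mat, F4.add_eq, F4.mul_eq, F4.o_eq, vecMulVec_apply]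

theorem exists_vecMulVec_of_mul_self {N : Matrix (Fin 3) (Fin 3) F4} (h : N * N = 0) :
    ∃ u p : Fin 3 → F4, N = vecMulVec u p := by
  have hrank := rank_add_rank_le_card_of_mul_eq_zero h
  rw [Fintype.card_fin] at hrank
  have hle : Module.finrank F4 N.mulVecLin.range ≤ 1 := by
    change N.rank ≤ 1
    omega
  obtain ⟨u, hu⟩ := finrank_le_one_iff.1 hle
  choose p hp using fun j => hu ⟨N *ᵥ Pi.single j 1, Pi.single j 1, rfl⟩
  refine ⟨u, p, ?_⟩
  ext i j
  have := congrFun (congrArg Subtype.val (hp j)) i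
  simpa [vecMulVec_apply, mul_comm] using this.symm

theorem exists_normalized_vecMulVec {N : Matrix (Fin 3) (Fin 3) F4} (h : N * N = 0) (h0 : N ≠ 0) :
    ∃ u p : Fin 3 → F4, N = vecMulVec u p ∧ p ⬝ᵥ u = 0 ∧
      (u 0 = 1 ∨ u 0 = 0 ∧ u 1 = 1 ∨ u 0 = 0 ∧ u 1 = 0 ∧ u 2 = 1) := by
  obtain ⟨u, p, rfl⟩ := exists_vecMulVec_of_mul_self h
  have hpu : p ⬝ᵥ u = 0 := by
    rw [vecMulVec_mul_vecMulVec] at h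
    by_contra hne
    exact h0 (by simpa [hne, vecMulVec_smul] using h)
  have key (c : F4) (hc : c ≠ 0) : vecMulVec u p = vecMulVec (c⁻¹ • u) (c • p) ∧
      (c • p) ⬝ᵥ (c⁻¹ • u) = 0 := by
    constructor
    · rw [smul_vecMulVec, vecMulVec_smul, smul_smul, inv_mul_cancel₀ hc, one_smul]
    · rw [smul_dotProduct, dotProduct_smul, hpu, smul_zero, smul_zero]
  by_cases h₀ : u 0 = 0
  · by_cases h₁ : u 1 = 0
    · by_cases h₂ : u 2 = 0
      · refine absurd ?_ h0
        rw [show u = 0 by ext i; fin_cases i <;> assumption, zero_vecMulVec]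
      · exact ⟨_, _, (key _ h₂).1, (key _ h₂).2, by simp [h₀, h₁, h₂]⟩
    · exact ⟨_, _, (key _ h₁).1, (key _ h₁).2, by simp [h₀, h₁]⟩
  · exact ⟨_, _, (key _ h₀).1, (key _ h₀).2, by simp [h₀]⟩

theorem exists_transl {g : G4} (hg : g ^ 2 = 1) (hg1 : g ≠ 1) : ∃ u p : Fin 3 → F4,
    Rep g (M3.transl (u 0) (u 1) (u 2) (p 0) (p 1) (p 2)) ∧ p ⬝ᵥ u = 0 ∧
      (u 0 = 1 ∨ u 0 = 0 ∧ u 1 = 1 ∨ u 0 = 0 ∧ u 1 = 0 ∧ u 2 = 1) := by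
  obtain ⟨A, hA⟩ := exists_rep g
  obtain ⟨r, hr, hM⟩ := M3.eqv_iff.1 (((hA.pow 2).eqv_iff Rep.one).2 hg)
  rw [M3.mat_pow, M3.mat_one] at hM
  have hB := hA.smul hr
  have hBB : (A.smul r).mat * (A.smul r).mat = 1 := by
    rw [← sq, M3.mat_smul, smul_pow, hM, smul_smul, ← pow_succ, F4.pow_three r hr, one_smul]
  have hN : (1 + (A.smul r).mat) * (1 + (A.smul r).mat) = 0 := by
    rw [add_mul, mul_add, mul_add, hBB, one_mul, one_mul, mul_one, add_comm 1,
      CharTwo.add_self_eq_zero]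
  have hN0 : 1 + (A.smul r).mat ≠ 0 := by
    intro h
    refine hg1 (Rep.ext (A := A.smul r) hB ?_)
    convert Rep.one
    apply M3.mat_injective
    rw [M3.mat_one, ← sub_eq_zero, CharTwo.sub_eq_add, add_comm, h]
  obtain ⟨u, p, hup, h⟩ := exists_normalized_vecMulVec hN hN0
  refine ⟨u, p, ?_, h⟩
  convert hB
  apply M3.mat_injective
  rw [mat_transl, ← hup, ← add_assoc, CharTwo.add_self_eq_zero, zero_add]

theorem rep_relWord {g : G4} {V : M3} (hg : Rep g V) :
    Rep (x * g * x * g * x ^ 3 * g) (M3.relWord V) :=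
  ((((rep_x.mul hg).mul rep_x).mul hg).mul (rep_x.pow 3)).mul hg

theorem rel_iff {g : G4} {V : M3} (hg : Rep g V) :
    M3.rel V = true ↔ (x * g * x * g * x ^ 3 * g) ^ 3 = 1 :=
  ((rep_relWord hg).pow 3).eqv_iff Rep.one

theorem exists_conj_of_rel {g : G4} (hg : g ^ 2 = 1) (hg1 : g ≠ 1)
    (hrel : (x * g * x * g * x ^ 3 * g) ^ 3 = 1) :
    ∃ p, ∃ k : ℤ, g = x ^ k * fixAut p t * (x ^ k)⁻¹ := by
  obtain ⟨u, p, hV, hpu, hu⟩ := exists_transl hg hg1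
  refine exists_conj_of_search (n := 7) hV ?_
  have hdot : M3.dot (u 0) (u 1) (u 2) (p 0) (p 1) (p 2) = F4.z := by
    rw [← hpu.trans F4.z_eq.symm, dotProduct_comm]
    simp [dotProduct, Fin.sum_univ_three, M3.dot, F4.add_eq, F4.mul_eq, add_assoc]
  have hone : (M3.transl (u 0) (u 1) (u 2) (p 0) (p 1) (p 2)).beq M3.one = false := by
    rw [Bool.eq_false_iff, Ne, M3.beq_iff]
    exact fun h => hg1 (hV.ext (h ▸ Rep.one))
  have hcheck := M3.search_transl
  simp only [F4.all_iff, Bool.and_eq_true] at hcheck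
  have hr := (rel_iff hV).2 hrel
  obtain ⟨⟨c0, c1⟩, c2⟩ := hcheck
  rw [← F4.o_eq, ← F4.z_eq] at hu
  obtain h | ⟨h, h'⟩ | ⟨h, h', h''⟩ := hu
  · rw [h] at hdot hone hr ⊢
    simpa [hone, hr, F4.beq_iff.2 hdot] using c0 (u 1) (u 2) (p 0) (p 1) (p 2)
  · rw [h, h'] at hdot hone hr ⊢
    simpa [hone, hr, F4.beq_iff.2 hdot] using c1 (u 2) (p 0) (p 1) (p 2)
  · rw [h, h', h''] at hdot hone hr ⊢
    simpa [hone, hr, F4.beq_iff.2 hdot] using c2 (p 0) (p 1) (p 2)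

theorem exists_conj_of_map_eq (ψ : MulAut G4) (hψ : ψ x = x) :
    ∃ p, ∃ k : ℤ, ψ t = x ^ k * fixAut p t * (x ^ k)⁻¹ := by
  refine exists_conj_of_rel ?_ ?_ ?_
  · rw [← map_pow, ((rep_t.pow 2).eqv_iff Rep.one).1 (by decide +kernel), map_one]
  · rw [Ne, map_eq_one_iff ψ ψ.injective, ← rep_t.eqv_iff Rep.one]
    decide +kernel
  · have h := congrArg ψ ((rel_iff rep_t).1 M3.relWord_T)
    simpa [hψ] using h

theorem rep_ofWord (l : List ℕ) :
    ∃ g ∈ Subgroup.closure ({x, t} : Set G4), Rep g (M3.ofWord l) := by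
  have hx : x ∈ Subgroup.closure ({x, t} : Set G4) := Subgroup.subset_closure (by simp)
  have ht : t ∈ Subgroup.closure ({x, t} : Set G4) := Subgroup.subset_closure (by simp)
  induction l with
  | nil => exact ⟨1, one_mem _, Rep.one⟩
  | cons k l ih =>
    obtain ⟨g, hg, hl⟩ := ih
    cases l with
    | nil => exact ⟨x ^ k, pow_mem hx k, rep_x.pow k⟩
    | cons =>
      exact ⟨x ^ k * t * g, mul_mem (mul_mem (pow_mem hx k) ht) hg,
        ((rep_x.pow k).mul rep_t).mul hl⟩

theorem mem_closure_of_eqv {S : SL4} {l : List ℕ} {M : Matrix (Fin 3) (Fin 3) F4}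
    (h : (M3.ofWord l).eqv (M3.of M) = true) (hS : (S : Matrix (Fin 3) (Fin 3) F4) = M) :
    (S : G4) ∈ Subgroup.closure ({x, t} : Set G4) := by
  obtain ⟨g, hg, hl⟩ := rep_ofWord l
  have hS' : Rep (S : G4) (M3.of M) := ⟨S, rfl, by rw [hS, M3.mat_of]⟩
  rwa [← (hl.eqv_iff hS').1 h]

theorem closure_eq_top : Subgroup.closure ({x, t} : Set G4) = ⊤ := by
  refine (Subgroup.eq_top_iff' _).2 fun g => ?_
  obtain ⟨S, rfl⟩ := QuotientGroup.mk_surjective g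
  refine Matrix.SpecialLinearGroup.diagonal_transvection_induction'
    (fun S => (S : G4) ∈ Subgroup.closure ({x, t} : Set G4)) S ?_ ?_ ?_
  · exact fun i j hij c hc => mem_closure_of_eqv (M3.ofWord_diagWord i j hij c hc) rfl
  · exact fun i j hij c => mem_closure_of_eqv (M3.ofWord_word i j hij c) rfl
  · exact fun A B hA hB => mul_mem hA hB

theorem outOrder_eq : outOrder G4 = 12 := by
  refine (card_quotient_inner_eq x t closure_eq_top
    (exists_map_eq_conj (k := 2880) (by rw [card_eq]) (by norm_num) x y orderOf_x y_conj_x)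
    (fun _ => eq_zpow_of_conj_eq) conj_ne_inv fixAut fixAut_x dualAut dualAut_x
    exists_conj_of_map_eq conj_fixAut_t_injective).trans ?_
  simp

/-- The elements `root a b` form a subgroup. -/
def rootHom : Multiplicative (F4 × F4) →* G4 :=
  MonoidHom.mk' (fun p => ofM3 (M3.root p.toAdd.1 p.toAdd.2) (by
    obtain ⟨a, b⟩ := p
    cases a <;> cases b <;> rfl)) fun p q => by
    refine Rep.ext (rep_ofM3 _ _) ?_
    convert (rep_ofM3 _ _).mul (rep_ofM3 _ _) using 1
    obtain ⟨a, b⟩ := p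
    obtain ⟨a', b'⟩ := q
    cases a <;> cases b <;> cases a' <;> cases b' <;> rfl

theorem rep_rootHom (a b : F4) : Rep (rootHom (.ofAdd (a, b))) (M3.root a b) :=
  ⟨_, rfl, rfl⟩

theorem rootHom_injective : Function.Injective rootHom := by
  rw [injective_iff_map_eq_one]
  rintro ⟨a, b⟩ h
  have h' := ((rep_rootHom a b).eqv_iff Rep.one).2 h
  cases a <;> cases b <;> first | rfl | exact absurd h' (by decide)

theorem isConj_rootHom {a b : F4} (h : (a, b) ≠ 0) :
    IsConj (rootHom (.ofAdd (F4.o, F4.z))) (rootHom (.ofAdd (a, b))) := by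
  obtain ⟨hdet, hmul⟩ := M3.root_conj a b h
  have hg := rep_ofM3 _ hdet
  rw [isConj_iff]
  refine ⟨_, mul_inv_eq_of_eq_mul (Rep.ext (hg.mul (rep_rootHom _ _)) ?_)⟩
  rw [hmul]
  exact (rep_rootHom a b).mul hg

theorem twentyone_le {n : ℕ} (φ : G4 →* Equiv.Perm (Fin n)) (hφ : Function.Injective φ) :
    21 ≤ n := by
  refine twentyone_le_of_injective card_eq card_normalizer_le rootHom.range ?_
    (rootHom (.ofAdd (F4.o, F4.z))) ?_ ?_ φ hφ
  · rw [← Nat.card_congr (MonoidHom.ofInjective rootHom_injective).toEquiv,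
      Nat.card_congr Multiplicative.toAdd, Nat.card_prod, Nat.card_eq_fintype_card, F4.card_eq]
  · rw [Ne, map_eq_one_iff rootHom rootHom_injective]
    exact fun h => absurd (congrArg (fun p => (Multiplicative.toAdd p).1) h) (by decide)
  · rintro _ ⟨⟨a, b⟩, rfl⟩ h
    refine isConj_rootHom fun h0 => h ?_
    rw [← map_one rootHom]
    exact congrArg (fun p => rootHom (.ofAdd p)) h0

open scoped LinearAlgebra.Projectivization in
open Projectivization in
theorem exists_injective : ∃ f : G4 →* Equiv.Perm (Fin 21), Function.Injective f := by
  have hc : Nat.card (ℙ F4 (Fin 3 → F4)) = 21 := by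
    rw [Projectivization.card_of_finrank (n := 3) F4 (Fin 3 → F4) (by simp),
      Nat.card_eq_fintype_card, F4.card_eq]
    rfl
  have : Finite (ℙ F4 (Fin 3 → F4)) := Nat.finite_of_card_ne_zero (by rw [hc]; norm_num)
  let e : ℙ F4 (Fin 3 → F4) ≃ Fin 21 := Finite.equivFinOfCardEq hc
  exact ⟨e.permCongrHom.toMonoidHom.comp PSLAction.toPermHom,
    e.permCongrHom.injective.comp Matrix.ProjectiveSpecialLinearGroup.toPermHom_injective⟩

theorem minFaithfulDegree_eq : minFaithfulDegree G4 = 21 :=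
  le_antisymm (Nat.sInf_le exists_injective)
    (le_csInf ⟨21, exists_injective⟩ fun _ ⟨φ, hφ⟩ => twentyone_le φ hφ)

end G4

theorem minFaithfulDegree_congr {G H : Type*} [Group G] [Group H] (e : G ≃* H) :
    minFaithfulDegree G = minFaithfulDegree H := by
  refine congrArg sInf (Set.ext fun n => ⟨?_, ?_⟩)
  · exact fun ⟨f, hf⟩ => ⟨f.comp e.symm.toMonoidHom, hf.comp e.symm.injective⟩
  · exact fun ⟨f, hf⟩ => ⟨f.comp e.toMonoidHom, hf.comp e.injective⟩

theorem outOrder_congr {G H : Type*} [Group G] [Group H] (e : G ≃* H) :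
    outOrder G = outOrder H := by
  have key (g : G) : MulAut.congr e (MulAut.conj g) = MulAut.conj (e g) := by
    ext h
    simp
  have hmap : (MulAut.conj : G →* MulAut G).range.map (MulAut.congr e).toMonoidHom =
      (MulAut.conj : H →* MulAut H).range := by
    ext f
    rw [Subgroup.mem_map]
    constructor
    · rintro ⟨_, ⟨g, rfl⟩, rfl⟩
      exact ⟨e g, (key g).symm⟩
    · rintro ⟨h, rfl⟩
      refine ⟨_, ⟨e.symm h, rfl⟩, (key _).trans ?_⟩
      rw [e.apply_symm_apply]
  change Subgroup.index _ = Subgroup.index _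
  rw [← hmap]
  exact (Subgroup.index_map_equiv _ (MulAut.congr e)).symm

/-- A ring isomorphism induces an isomorphism of special linear groups. -/
def specialLinearGroupCongr {n R S : Type*} [Fintype n] [DecidableEq n] [CommRing R] [CommRing S]
    (e : R ≃+* S) : Matrix.SpecialLinearGroup n R ≃* Matrix.SpecialLinearGroup n S where
  toFun := Matrix.SpecialLinearGroup.map (e : R →+* S)
  invFun := Matrix.SpecialLinearGroup.map (e.symm : S →+* R)
  map_mul' := map_mul _
  left_inv A := by ext; simp
  right_inv A := by ext; simp

/-- Isomorphic groups have isomorphic quotients by their centers. -/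
def quotientCenterCongr {G H : Type*} [Group G] [Group H] (e : G ≃* H) :
    G ⧸ Subgroup.center G ≃* H ⧸ Subgroup.center H :=
  QuotientGroup.congr _ _ e (by
    ext h
    rw [Subgroup.mem_map]
    constructor
    · rintro ⟨g, hg, rfl⟩
      exact MulEquivClass.apply_mem_center e hg
    · exact fun hh => ⟨e.symm h, MulEquivClass.apply_mem_center e.symm hh, e.apply_symm_apply h⟩)

theorem nonempty_PSL34_equiv : Nonempty (PSL34 ≃* G4) := by
  have := Fintype.ofFinite (GaloisField 2 2)
  have hc : Fintype.card (GaloisField 2 2) = Fintype.card F4 := by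
    rw [← Nat.card_eq_fintype_card, GaloisField.card 2 2 two_ne_zero, F4.card_eq]
    rfl
  exact ⟨quotientCenterCongr (specialLinearGroupCongr (FiniteField.ringEquivOfCardEq hc))⟩

/-- `P(PSL(3,4)) = 21` and `|Out(PSL(3,4))| = 12`; in particular
`P(PSL(3,4)) < 2 |Out(PSL(3,4))|`. -/
theorem PSL34_minFaithfulDegree_and_outOrder :
    minFaithfulDegree PSL34 = 21 ∧ outOrder PSL34 = 12 ∧
      minFaithfulDegree PSL34 < 2 * outOrder PSL34 := by
  obtain ⟨e⟩ := nonempty_PSL34_equiv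
  rw [minFaithfulDegree_congr e, outOrder_congr e, G4.minFaithfulDegree_eq, G4.outOrder_eq]
  norm_num
end

section
/- Let $X$ be a finite group and let $N$ be a normal subgroup of $X$ such that the quotient group $X/N$ has no nontrivial abelian normal subgroup. Then $P(X/N) \le P(X)$, where $P(Y)$ denotes the minimal faithful permutation degree of the finite group $Y$. -/
universe u

open Subgroup

section DerivedIter

variable {G : Type*} [Group G]

/-- The `n`-th term of the derived series of a subgroup `S`, as a subgroup of the ambient group. -/
def derivedIter (S : Subgroup G) : ℕ → Subgroup G
  | 0 => S
  | n + 1 => ⁅derivedIter S n, derivedIter S n⁆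

theorem derivedIter_mono {S T : Subgroup G} (h : S ≤ T) (n : ℕ) :
    derivedIter S n ≤ derivedIter T n := by
  induction n with
  | zero => exact h
  | succ n ih => exact commutator_mono ih ih

theorem derivedIter_normal (S : Subgroup G) [hS : S.Normal] (n : ℕ) :
    (derivedIter S n).Normal := by
  induction n with
  | zero => exact hS
  | succ n ih => exact commutator_normal _ _

theorem derivedIter_antitone (S : Subgroup G) : Antitone (derivedIter S) := by
  refine antitone_nat_of_succ_le fun n => ?_
  refine commutator_le.2 fun a ha b hb => ?_
  exact mul_mem (mul_mem (mul_mem ha hb) (inv_mem ha)) (inv_mem hb)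

theorem derivedIter_add (S : Subgroup G) (m n : ℕ) :
    derivedIter S (m + n) = derivedIter (derivedIter S m) n := by
  induction n with
  | zero => rfl
  | succ n ih =>
    change ⁅derivedIter S (m + n), derivedIter S (m + n)⁆ = _
    rw [ih]
    rfl

theorem map_derivedIter {G' : Type*} [Group G'] (f : G →* G') (S : Subgroup G) (n : ℕ) :
    (derivedIter S n).map f = derivedIter (S.map f) n := by
  induction n with
  | zero => rfl
  | succ n ih =>
    change Subgroup.map f ⁅_, _⁆ = ⁅_, _⁆
    rw [map_commutator, ih]

theorem derivedIter_sup_le (S T : Subgroup G) [T.Normal] (n : ℕ) :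
    derivedIter (S ⊔ T) n ≤ derivedIter S n ⊔ T := by
  have h : (S ⊔ T).map (QuotientGroup.mk' T) = S.map (QuotientGroup.mk' T) := by
    rw [Subgroup.map_sup, QuotientGroup.map_mk'_self, sup_bot_eq]
  have h2 := map_derivedIter (QuotientGroup.mk' T) (S ⊔ T) n
  rw [h, ← map_derivedIter] at h2
  have h3 := (Subgroup.map_eq_map_iff.1 h2).le
  rw [QuotientGroup.ker_mk'] at h3
  exact le_sup_left.trans h3

theorem derivedIter_subgroupOf_le (S A : Subgroup G) (n : ℕ) :
    derivedIter (S.subgroupOf A) n ≤ (derivedIter S n).subgroupOf A := by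
  refine Subgroup.map_le_iff_le_comap.1 ?_
  rw [map_derivedIter]
  exact derivedIter_mono (map_comap_le _ _) n

theorem exists_derivedIter_eq_bot (S : Subgroup G) [hS : Group.IsSolvable S] :
    ∃ n, derivedIter S n = ⊥ := by
  obtain ⟨n, hn⟩ := hS.solvable
  have h : ∀ n, derivedSeries S n = derivedIter ⊤ n := fun n => by
    induction n with
    | zero => rfl
    | succ n ih => rw [derivedSeries_succ, ih]; rfl
  refine ⟨n, ?_⟩
  have h2 := map_derivedIter S.subtype ⊤ n
  rw [← h, hn, Subgroup.map_bot, ← MonoidHom.range_eq_map, range_subtype] at h2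
  exact h2.symm

theorem eq_bot_of_derivedIter_eq_bot
    (h : ∀ K : Subgroup G, K.Normal → (∀ a ∈ K, ∀ b ∈ K, a * b = b * a) → K = ⊥)
    (S : Subgroup G) [S.Normal] (n : ℕ) (hn : derivedIter S n = ⊥) : S = ⊥ := by
  induction n with
  | zero => exact hn
  | succ n ih =>
    refine ih (h _ (derivedIter_normal S n) fun a ha b hb => ?_)
    have : a * b * a⁻¹ * b⁻¹ ∈ derivedIter S (n + 1) := commutator_mem_commutator ha hb
    rw [hn, mem_bot] at this
    exact mul_inv_eq_iff_eq_mul.1 (mul_inv_eq_one.1 this)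

/-- `S` is solvable modulo `C`. -/
def SolvableOver (C S : Subgroup G) : Prop :=
  ∃ n, derivedIter S n ≤ C

theorem SolvableOver.mono {C D S T : Subgroup G} (h : SolvableOver C S) (hC : C ≤ D)
    (hS : T ≤ S) : SolvableOver D T :=
  h.imp fun n hn => (derivedIter_mono hS n).trans (hn.trans hC)

theorem SolvableOver.trans {C D S : Subgroup G} (h : SolvableOver C D) (h' : SolvableOver D S) :
    SolvableOver C S := by
  obtain ⟨n, hn⟩ := h
  obtain ⟨m, hm⟩ := h'
  exact ⟨m + n, derivedIter_add S m n ▸ (derivedIter_mono hm n).trans hn⟩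

theorem SolvableOver.sup {C S T : Subgroup G} [C.Normal] [T.Normal] (hS : SolvableOver C S)
    (hT : SolvableOver C T) : SolvableOver C (S ⊔ T) := by
  obtain ⟨m, hm⟩ := hT
  obtain ⟨n, hn⟩ := hS
  have h1 : SolvableOver C (C ⊔ T) :=
    ⟨m, sup_comm C T ▸ (derivedIter_sup_le T C m).trans (sup_le hm le_rfl)⟩
  exact h1.trans ⟨n, (derivedIter_sup_le S T n).trans (sup_le_sup_right hn T)⟩

theorem SolvableOver.inf {C D S T : Subgroup G} (hS : SolvableOver C S)
    (hT : SolvableOver D T) : SolvableOver (C ⊓ D) (S ⊓ T) := by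
  obtain ⟨m, hm⟩ := hT
  obtain ⟨n, hn⟩ := hS
  refine ⟨max n m, le_inf ?_ ?_⟩
  · exact (derivedIter_mono inf_le_left _).trans
      ((derivedIter_antitone S (le_max_left n m)).trans hn)
  · exact (derivedIter_mono inf_le_right _).trans
      ((derivedIter_antitone T (le_max_right n m)).trans hm)

theorem SolvableOver.subgroupOf {C S : Subgroup G} (h : SolvableOver C S) (A : Subgroup G) :
    SolvableOver (C.subgroupOf A) (S.subgroupOf A) :=
  h.imp fun n hn => (derivedIter_subgroupOf_le S A n).trans (Subgroup.comap_mono hn)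

theorem SolvableOver.map {A : Subgroup G} {C S : Subgroup A} (h : SolvableOver C S) :
    SolvableOver (C.map A.subtype) (S.map A.subtype) :=
  h.imp fun n hn => map_derivedIter A.subtype S n ▸ Subgroup.map_mono hn

/-- `K` is the largest normal subgroup that is solvable modulo `C`. -/
structure IsRadicalOver (C K : Subgroup G) : Prop where
  normal : K.Normal
  solvable : SolvableOver C K
  le : ∀ S : Subgroup G, S.Normal → SolvableOver C S → S ≤ K

theorem exists_isRadicalOver [Finite G] (C : Subgroup G) [hC : C.Normal] :
    ∃ K, IsRadicalOver C K := by
  obtain ⟨K, ⟨hK, hK'⟩, hmax⟩ := (Set.toFinite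
    {S : Subgroup G | S.Normal ∧ SolvableOver C S}).exists_maximal ⟨C, hC, 0, le_rfl⟩
  refine ⟨K, hK, hK', fun S hS hS' => ?_⟩
  exact le_sup_left.trans (hmax ⟨sup_normal S K, hS'.sup hK'⟩ le_sup_right)

end DerivedIter

section PermRep

variable {G : Type u} [Group G]

/-- `K` is the kernel of a permutation representation of degree `n`. -/
def HasPermRep (K : Subgroup G) (n : ℕ) : Prop :=
  ∃ f : G →* Equiv.Perm (Fin n), f.ker = K

theorem hasPermRep_ker {Ω : Type*} [Finite Ω] (f : G →* Equiv.Perm Ω) {n : ℕ}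
    (h : Nat.card Ω ≤ n) : HasPermRep f.ker n := by
  let e : Ω ↪ Fin n := (Finite.equivFin Ω).toEmbedding.trans (Fin.castLEEmb h)
  refine ⟨(Equiv.Perm.viaEmbeddingHom e).comp f, ?_⟩
  exact MonoidHom.ker_comp_of_injective _ _ (Equiv.Perm.viaEmbeddingHom_injective e)

theorem HasPermRep.normal {K : Subgroup G} {n : ℕ} (h : HasPermRep K n) : K.Normal := by
  obtain ⟨f, rfl⟩ := h
  infer_instance

theorem HasPermRep.inf {K L : Subgroup G} {m n : ℕ} (hK : HasPermRep K m)
    (hL : HasPermRep L n) : HasPermRep (K ⊓ L) (m + n) := by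
  obtain ⟨f, rfl⟩ := hK
  obtain ⟨g, rfl⟩ := hL
  have h := hasPermRep_ker ((Equiv.Perm.sumCongrHom (Fin m) (Fin n)).comp (f.prod g))
    (n := m + n) (by simp)
  rwa [MonoidHom.ker_comp_of_injective _ _ Equiv.Perm.sumCongrHom_injective,
    MonoidHom.ker_prod] at h

theorem QuotientGroup.out_inv_mul_mul_out_mem (H : Subgroup G) (x : G) (c : G ⧸ H) :
    (x • c).out⁻¹ * x * c.out ∈ H := by
  rw [mul_assoc, ← QuotientGroup.eq, QuotientGroup.out_eq', ← smul_eq_mul,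
    ← MulAction.Quotient.smul_mk, QuotientGroup.out_eq']

/-- The action of `G` on `(G ⧸ H) × B` induced from an action of the subgroup `H` on `B`. -/
noncomputable def inducedPermHom (H : Subgroup G) {B : Type*} (ρ : H →* Equiv.Perm B) :
    G →* Equiv.Perm ((G ⧸ H) × B) :=
  MonoidHom.toHomPerm
    { toFun := fun x p =>
        (x • p.1, ρ ⟨_, QuotientGroup.out_inv_mul_mul_out_mem H x p.1⟩ p.2)
      map_one' := by
        funext p
        refine Prod.ext (one_smul _ _) ?_
        have : (⟨_, QuotientGroup.out_inv_mul_mul_out_mem H 1 p.1⟩ : H) = 1 := by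
          ext; simp
        simp only [this, map_one]
        rfl
      map_mul' := fun x y => by
        funext p
        refine Prod.ext (mul_smul _ _ _) ?_
        have : (⟨_, QuotientGroup.out_inv_mul_mul_out_mem H (x * y) p.1⟩ : H) =
            ⟨_, QuotientGroup.out_inv_mul_mul_out_mem H x (y • p.1)⟩ *
              ⟨_, QuotientGroup.out_inv_mul_mul_out_mem H y p.1⟩ := by
          ext; simp [mul_smul, mul_assoc]
        simp only [this, map_mul]
        rfl }

theorem inducedPermHom_apply (H : Subgroup G) {B : Type*} (ρ : H →* Equiv.Perm B) (x : G)
    (p : (G ⧸ H) × B) : inducedPermHom H ρ x p =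
      (x • p.1, ρ ⟨_, QuotientGroup.out_inv_mul_mul_out_mem H x p.1⟩ p.2) :=
  rfl

theorem ker_inducedPermHom (H : Subgroup G) {B : Type*} [Nonempty B] (ρ : H →* Equiv.Perm B) :
    (inducedPermHom H ρ).ker = (ρ.ker.map H.subtype).normalCore := by
  refine le_antisymm ?_ ?_
  · rw [normal_le_normalCore]
    intro x hx
    have hx' : ∀ p, inducedPermHom H ρ x p = p := fun p => by
      rw [MonoidHom.mem_ker.1 hx]; rfl
    set c : G ⧸ H := QuotientGroup.mk 1
    have hc : c.out ∈ H := by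
      have := QuotientGroup.out_eq' c
      rw [eq_comm, QuotientGroup.eq] at this
      simpa using this
    have h1 : x • c = c := congrArg Prod.fst (hx' (c, Classical.arbitrary B))
    have hm := QuotientGroup.out_inv_mul_mul_out_mem H x c
    have h2 : (⟨_, hm⟩ : H) ∈ ρ.ker := by
      rw [MonoidHom.mem_ker]
      ext b
      exact congrArg Prod.snd (hx' (c, b))
    have h3 := (MonoidHom.normal_ker ρ).conj_mem _ h2 ⟨_, hc⟩
    refine ⟨_, h3, ?_⟩
    simp [h1, mul_assoc]
  · intro x hx
    rw [MonoidHom.mem_ker]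
    ext1 p
    rw [inducedPermHom_apply]
    have hx' : ∀ g : G, g⁻¹ * x * g ∈ ρ.ker.map H.subtype := fun g => by
      simpa using hx g⁻¹
    have h1 : x • p.1 = p.1 := by
      obtain ⟨y, -, hy⟩ := hx' p.1.out
      conv_rhs => rw [← QuotientGroup.out_eq' p.1]
      conv_lhs => rw [← QuotientGroup.out_eq' p.1]
      rw [MulAction.Quotient.smul_mk, eq_comm, QuotientGroup.eq, smul_eq_mul, ← mul_assoc, ← hy]
      exact y.2
    refine Prod.ext h1 ?_
    obtain ⟨y, hy, hy'⟩ := hx' p.1.out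
    have h2 : (⟨_, QuotientGroup.out_inv_mul_mul_out_mem H x p.1⟩ : H) = y := by
      ext
      change (x • p.1).out⁻¹ * x * p.1.out = y
      rw [h1]
      exact hy'.symm
    change ρ _ p.2 = p.2
    rw [h2, MonoidHom.mem_ker.1 hy]
    rfl

theorem HasPermRep.induced [Finite G] {H : Subgroup G} {K : Subgroup H} {m : ℕ} (hm : m ≠ 0)
    (h : HasPermRep K m) : HasPermRep (K.map H.subtype).normalCore (H.index * m) := by
  obtain ⟨ρ, rfl⟩ := h
  have : NeZero m := ⟨hm⟩
  rw [← ker_inducedPermHom]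
  exact hasPermRep_ker _ (by simp [Nat.card_prod, Subgroup.index])

theorem HasPermRep.of_supplement {A N : Subgroup G} [N.Normal] (hAN : A ⊔ N = ⊤)
    {L : Subgroup A} {m : ℕ} (hL : HasPermRep L m) (hN : N.subgroupOf A ≤ L) :
    HasPermRep (L.map A.subtype ⊔ N) m := by
  obtain ⟨φ, rfl⟩ := hL
  let q : A →* G ⧸ N := (QuotientGroup.mk' N).comp A.subtype
  have hdecomp : ∀ g : G, ∃ a ∈ A, ∃ x ∈ N, a * x = g := fun g =>
    mem_sup_of_normal_right.1 (hAN ▸ mem_top g)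
  have hq : Function.Surjective q := fun y => by
    obtain ⟨g, rfl⟩ := QuotientGroup.mk'_surjective N y
    obtain ⟨a, ha, x, hx, rfl⟩ := hdecomp g
    exact ⟨⟨a, ha⟩, QuotientGroup.eq.2 (by simpa using hx)⟩
  have hk : q.ker ≤ φ.ker := by
    refine le_trans (le_of_eq ?_) hN
    rw [← MonoidHom.comap_ker, QuotientGroup.ker_mk']
    rfl
  let ψ := q.liftOfSurjective hq ⟨φ, hk⟩
  have hψ : ∀ a : A, ψ (QuotientGroup.mk' N a) = φ a := fun a =>
    MonoidHom.liftOfRightInverse_comp_apply q _ _ ⟨φ, hk⟩ a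
  refine ⟨ψ.comp (QuotientGroup.mk' N), ?_⟩
  have hNM : N ≤ (ψ.comp (QuotientGroup.mk' N)).ker := fun x hx => by
    rw [MonoidHom.mem_ker, MonoidHom.comp_apply,
      QuotientGroup.mk'_apply, (QuotientGroup.eq_one_iff x).2 hx, map_one]
  refine le_antisymm (fun g hg => ?_) (sup_le ?_ hNM)
  · obtain ⟨a, ha, x, hx, rfl⟩ := hdecomp g
    refine mul_mem_sup ⟨⟨a, ha⟩, ?_, rfl⟩ hx
    have h1 := (Subgroup.mul_mem_cancel_right _ (hNM hx)).1 hg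
    rw [MonoidHom.mem_ker, MonoidHom.comp_apply] at h1
    exact (hψ ⟨a, ha⟩).symm.trans h1
  · rintro _ ⟨a, ha, rfl⟩
    exact (hψ a).trans ha

theorem exists_restrict_perm {Ω : Type*} (f : G →* Equiv.Perm Ω) (p : Ω → Prop)
    (h : ∀ g x, p (f g x) ↔ p x) :
    ∃ f' : G →* Equiv.Perm {x // p x}, ∀ g x, (f' g x : Ω) = f g x :=
  ⟨{ toFun := fun g => (f g).subtypePerm (h g)
     map_one' := by ext; simp
     map_mul' := fun a b => by ext; simp only [map_mul]; rfl }, fun _ _ => rfl⟩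

theorem exists_isRadicalOver_hasPermRep (n : ℕ) : ∀ (G : Type u) [Group G] [Finite G]
    (C : Subgroup G), HasPermRep C n → ∃ K, IsRadicalOver C K ∧ HasPermRep K n := by
  induction n using Nat.strong_induction_on with
  | _ n ih =>
  intro G _ _ C hC
  have hCn := hC.normal
  obtain ⟨K, hK⟩ := exists_isRadicalOver C
  have hKn := hK.normal
  have hCK : C ≤ K := hK.le C hCn ⟨0, le_rfl⟩
  obtain ⟨f, rfl⟩ := hC
  by_cases htrans : ∀ x y, ∃ g, f g x = y
  swap
  · push Not at htrans
    obtain ⟨x, y, hxy⟩ := htrans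
    let p : Fin n → Prop := fun z => ∃ g, f g x = z
    have hp : ∀ g z, p (f g z) ↔ p z := fun g z => by
      constructor
      · rintro ⟨a, ha⟩
        exact ⟨g⁻¹ * a, by simp [ha]⟩
      · rintro ⟨a, rfl⟩
        exact ⟨g * a, by simp⟩
    obtain ⟨f₁, h₁⟩ := exists_restrict_perm f p hp
    obtain ⟨f₂, h₂⟩ := exists_restrict_perm f (fun z => ¬ p z) fun g z => not_congr (hp g z)
    have hcard : Nat.card {z // p z} + Nat.card {z // ¬ p z} = n := by
      classical
      rw [← Nat.card_sum, Nat.card_congr (Equiv.sumCompl p), Nat.card_fin]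
    have hpos₁ : 0 < Nat.card {z // p z} :=
      Nat.card_pos_iff.2 ⟨⟨⟨x, 1, by simp⟩⟩, inferInstance⟩
    have hpos₂ : 0 < Nat.card {z // ¬ p z} :=
      Nat.card_pos_iff.2 ⟨⟨⟨y, fun ⟨g, hg⟩ => hxy g hg⟩⟩, inferInstance⟩
    obtain ⟨K₁, hK₁, hr₁⟩ := ih _ (by omega) G _ (hasPermRep_ker f₁ le_rfl)
    obtain ⟨K₂, hK₂, hr₂⟩ := ih _ (by omega) G _ (hasPermRep_ker f₂ le_rfl)
    have hker : f.ker = f₁.ker ⊓ f₂.ker := by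
      ext g
      simp only [mem_inf, MonoidHom.mem_ker]
      constructor
      · intro hg
        constructor <;> ext z : 2
        · rw [h₁, hg]; rfl
        · rw [h₂, hg]; rfl
      · rintro ⟨hg₁, hg₂⟩
        ext1 z
        by_cases hz : p z
        · rw [← h₁ g ⟨z, hz⟩, hg₁]; rfl
        · rw [← h₂ g ⟨z, hz⟩, hg₂]; rfl
    have hn₁ := hr₁.normal
    have hn₂ := hr₂.normal
    refine ⟨K₁ ⊓ K₂, ⟨inferInstance, hker ▸ hK₁.solvable.inf hK₂.solvable, ?_⟩,
      hcard ▸ hr₁.inf hr₂⟩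
    intro S hS hS'
    exact le_inf (hK₁.le S hS (hS'.mono (hker ▸ inf_le_left) le_rfl))
      (hK₂.le S hS (hS'.mono (hker ▸ inf_le_right) le_rfl))
  refine ⟨K, hK, ?_⟩
  rcases Nat.lt_or_ge n 2 with hn | hn
  · have : Subsingleton (Fin n) := Fin.subsingleton_iff_le_one.2 (by omega)
    refine ⟨f, le_antisymm hCK fun g _ => Subsingleton.elim _ _⟩
  let x : Fin n := ⟨0, by omega⟩
  let act : MulAction G (Fin n) := MulAction.compHom _ f
  have hsmul : ∀ (g : G) (z : Fin n), g • z = f g z := fun _ _ => rfl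
  have hpre : MulAction.IsPretransitive G (Fin n) := ⟨htrans⟩
  let A : Subgroup G := MulAction.stabilizer G x
  have hindex : A.index = n :=
    (MulAction.index_stabilizer_of_transitive G x).trans (Nat.card_fin n)
  have hCA : f.ker ≤ A := fun g hg => by
    change f g x = x
    rw [MonoidHom.mem_ker.1 hg]; rfl
  have hcore : A.normalCore ≤ f.ker := fun g hg => by
    rw [MonoidHom.mem_ker]
    ext1 z
    obtain ⟨a, rfl⟩ := htrans x z
    have h1 : f (a⁻¹ * g * a⁻¹⁻¹) x = x := hg a⁻¹
    rw [inv_inv, map_mul, map_mul, map_inv] at h1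
    exact (Equiv.Perm.inv_eq_iff_eq.1 h1).trans rfl
  by_cases hAK : A ⊔ K = ⊤
  · obtain ⟨f', hf'⟩ := exists_restrict_perm (f.comp A.subtype) (· ≠ x) fun a z => by
      refine not_congr ?_
      have ha : f a x = x := a.2
      conv_lhs => rw [← ha]
      exact (f a).injective.eq_iff
    have hker : f'.ker = f.ker.subgroupOf A := by
      ext a
      simp only [mem_subgroupOf, MonoidHom.mem_ker]
      constructor
      · intro ha
        ext1 z
        by_cases hz : z = x
        · subst hz; exact a.2
        · have := hf' a ⟨z, hz⟩
          rw [ha] at this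
          exact this.symm
      · intro ha
        ext z : 2
        rw [hf', MonoidHom.comp_apply, A.subtype_apply, ha]; rfl
    have hcard : Nat.card {z // z ≠ x} = n - 1 := by simp
    obtain ⟨L, hL, hr⟩ := ih (n - 1) (by omega) A _ (hasPermRep_ker f' hcard.le)
    rw [hker] at hL
    have hKL : K.subgroupOf A ≤ L := hL.le _ inferInstance (hK.solvable.subgroupOf A)
    have hM := hr.of_supplement hAK hKL
    have hMK : L.map A.subtype ⊔ K ≤ K := by
      refine hK.le _ hM.normal (SolvableOver.sup ?_ hK.solvable)
      exact hL.solvable.map.mono (map_comap_le _ _) le_rfl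
    rw [le_antisymm hMK le_sup_right] at hM
    obtain ⟨φ, rfl⟩ := hM
    exact hasPermRep_ker φ (by simp)
  · let H := A ⊔ K
    have hAH : A ≤ H := le_sup_left
    have hKH : K ≤ H := le_sup_right
    have hmul : H.index * A.relIndex H = n := by
      rw [mul_comm, relIndex_mul_index hAH, hindex]
    have hH1 : H.index ≠ 1 := fun h1 => hAK (index_eq_one.1 h1)
    have hm0 : A.relIndex H ≠ 0 := fun h0 => by rw [h0] at hmul; omega
    have hlt : A.relIndex H < n := by
      have : H.index ≠ 0 := fun h0 => by rw [h0] at hmul; omega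
      nlinarith [Nat.pos_of_ne_zero hm0, (by omega : 2 ≤ H.index)]
    have hr0 : HasPermRep (A.subgroupOf H).normalCore (A.relIndex H) := by
      rw [normalCore_eq_ker]
      exact hasPermRep_ker _ le_rfl
    obtain ⟨L, hL, hr⟩ := ih _ hlt H _ hr0
    have hCcore : f.ker.subgroupOf H ≤ (A.subgroupOf H).normalCore :=
      normal_le_normalCore.2 (Subgroup.comap_mono hCA)
    have hKL : K.subgroupOf H ≤ L :=
      hL.le _ inferInstance ((hK.solvable.subgroupOf H).mono hCcore le_rfl)
    have hM := hr.induced hm0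
    rw [hmul] at hM
    convert hM using 1
    refine le_antisymm ?_ ?_
    · rw [normal_le_normalCore]
      exact fun k hk => ⟨⟨k, hKH hk⟩, hKL hk, rfl⟩
    · refine hK.le _ inferInstance ?_
      obtain ⟨j, hj⟩ := hL.solvable.map.mono le_rfl (normalCore_le _)
      have hnor := derivedIter_normal (L.map H.subtype).normalCore j
      refine ⟨j, le_trans (normal_le_normalCore.2 (hj.trans ?_)) hcore⟩
      exact (Subgroup.map_mono (normalCore_le _)).trans (map_comap_le _ _)

theorem exists_minimal_supplement [Finite G] (N : Subgroup G) [N.Normal] :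
    ∃ H : Subgroup G, H ⊔ N = ⊤ ∧ N.subgroupOf H ≤ frattini H := by
  obtain ⟨H, hH, hmin⟩ := (Set.toFinite {H : Subgroup G | H ⊔ N = ⊤}).exists_minimal
    ⟨⊤, top_sup_eq N⟩
  refine ⟨H, hH, ?_⟩
  refine le_iInf₂ fun M hM => ?_
  by_contra hNM
  have htop : M ⊔ N.subgroupOf H = ⊤ :=
    hM.2 _ (lt_of_le_of_ne le_sup_left fun h => hNM (h ▸ le_sup_right))
  have h1 : M.map H.subtype ⊔ (N.subgroupOf H).map H.subtype = H := by
    rw [← Subgroup.map_sup, htop, ← MonoidHom.range_eq_map, range_subtype]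
  have h2 : M.map H.subtype ⊔ N = ⊤ := by
    rw [eq_top_iff, ← hH]
    refine sup_le ?_ le_sup_right
    calc H = _ := h1.symm
      _ ≤ _ := sup_le_sup_left (map_comap_le _ _) _
  have h3 : H ≤ M.map H.subtype := hmin h2 (map_subtype_le M)
  refine hM.1 (eq_top_iff.2 fun a _ => ?_)
  obtain ⟨b, hb, hba⟩ := h3 a.2
  rwa [← Subtype.ext hba]

theorem HasPermRep.quotient [Finite G] (N : Subgroup G) [N.Normal]
    (h : ∀ K : Subgroup (G ⧸ N), K.Normal → (∀ a ∈ K, ∀ b ∈ K, a * b = b * a) → K = ⊥)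
    {n : ℕ} (hn : HasPermRep (⊥ : Subgroup G) n) : HasPermRep N n := by
  obtain ⟨H, hHN, hfr⟩ := exists_minimal_supplement N
  have hrH : HasPermRep (⊥ : Subgroup H) n := by
    obtain ⟨f, hf⟩ := hn
    refine ⟨f.comp H.subtype, ?_⟩
    rw [← MonoidHom.comap_ker, hf, ← (MonoidHom.ker_eq_bot_iff _).2 H.subtype_injective]
    rfl
  obtain ⟨K, hK, hr⟩ := exists_isRadicalOver_hasPermRep n H ⊥ hrH
  have hKn := hK.normal
  have hfrK : SolvableOver ⊥ (N.subgroupOf H) := by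
    have := frattini_nilpotent (G := H)
    exact SolvableOver.mono ((exists_derivedIter_eq_bot (frattini H)).imp fun _ => le_of_eq)
      le_rfl hfr
  have hNK := hK.le _ inferInstance hfrK
  have hM := hr.of_supplement hHN hNK
  have hMn := hM.normal
  have hle : K.map H.subtype ⊔ N ≤ N := by
    obtain ⟨j, hj⟩ := hK.solvable.map
    have h1 : derivedIter (K.map H.subtype ⊔ N) j ≤ N :=
      (derivedIter_sup_le _ _ j).trans (sup_le (hj.trans (by simp)) le_rfl)
    have hnor : ((K.map H.subtype ⊔ N).map (QuotientGroup.mk' N)).Normal :=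
      hMn.map _ (QuotientGroup.mk'_surjective N)
    have h2 := eq_bot_of_derivedIter_eq_bot h ((K.map H.subtype ⊔ N).map (QuotientGroup.mk' N)) j
      (by rwa [← map_derivedIter, Subgroup.map_eq_bot_iff, QuotientGroup.ker_mk'])
    rwa [Subgroup.map_eq_bot_iff, QuotientGroup.ker_mk'] at h2
  rwa [le_antisymm hle le_sup_right] at hM

end PermRep

/-- If `N` is a normal subgroup of a finite group `X` such that `X/N` has no nontrivial
abelian normal subgroup, then `P(X/N) ≤ P(X)`. -/
theorem minFaithfulDegree_quotient_le (X : Type*) [Group X] [Finite X]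
    (N : Subgroup X) [N.Normal]
    (h : ∀ K : Subgroup (X ⧸ N), K.Normal → (∀ a ∈ K, ∀ b ∈ K, a * b = b * a) → K = ⊥) :
    minFaithfulDegree (X ⧸ N) ≤ minFaithfulDegree X := by
  have hne : {n : ℕ | ∃ f : X →* Equiv.Perm (Fin n), Function.Injective f}.Nonempty := by
    have h1 := hasPermRep_ker (MulAction.toPermHom X X) le_rfl
    rw [(MonoidHom.ker_eq_bot_iff _).2 MulAction.toPerm_injective] at h1
    obtain ⟨f, hf⟩ := h1
    exact ⟨_, f, (MonoidHom.ker_eq_bot_iff _).1 hf⟩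
  have hrep : HasPermRep (⊥ : Subgroup X) (minFaithfulDegree X) :=
    (Nat.sInf_mem hne).imp fun f hf => (MonoidHom.ker_eq_bot_iff f).2 hf
  obtain ⟨g, hg⟩ := HasPermRep.quotient N h hrep
  refine Nat.sInf_le ⟨QuotientGroup.lift N g hg.ge, ?_⟩
  rw [← MonoidHom.ker_eq_bot_iff, QuotientGroup.ker_lift, hg, QuotientGroup.map_mk'_self]
end

section
/- Let $n \ge 1$ and let $G$ be a nontrivial subgroup of the symmetric group $\mathrm{Sym}(n)$. Then every chief series $1 = N_0 < N_1 < \cdots < N_u = G$ of $G$ has length $u \le n - 1$. -/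
open Equiv (Perm)

universe u v

section NormalLength

variable {G : Type v} [Group G]

/-- There is a rank function with values at most `k` on the subgroups of `G` that is monotone on
normal subgroups and, modulo `C`, strictly monotone on them; in particular chains of normal
subgroups containing `C` have length at most `k`. -/
def NormalLengthLE (C : Subgroup G) (k : ℕ) : Prop :=
  ∃ f : Subgroup G → ℕ, (∀ N, f N ≤ k) ∧
    ∀ N N' : Subgroup G, N.Normal → N'.Normal → N ≤ N' →
      f N ≤ f N' ∧ (f N' ≤ f N → N' ≤ N ⊔ C)

theorem NormalLengthLE.mono {C C' : Subgroup G} {k k' : ℕ} (h : NormalLengthLE C k)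
    (hC : C ≤ C') (hk : k ≤ k') : NormalLengthLE C' k' := by
  obtain ⟨f, hf, hf'⟩ := h
  refine ⟨f, fun N => (hf N).trans hk, fun N N' hN hN' hle => ?_⟩
  exact ⟨(hf' N N' hN hN' hle).1, fun h =>
    ((hf' N N' hN hN' hle).2 h).trans (sup_le_sup_left hC N)⟩

theorem NormalLengthLE.of_eq_top {C : Subgroup G} (hC : C = ⊤) (k : ℕ) : NormalLengthLE C k :=
  ⟨fun _ => 0, fun _ => Nat.zero_le k, fun _ _ _ _ _ => ⟨le_rfl, fun _ => by simp [hC]⟩⟩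

theorem NormalLengthLE.add {K C : Subgroup G} {D : Subgroup K} {a b : ℕ}
    (hK : NormalLengthLE K a) (hD : NormalLengthLE D b) (hDC : D.map K.subtype ≤ C) :
    NormalLengthLE C (a + b) := by
  obtain ⟨f₁, hf₁, hf₁'⟩ := hK
  obtain ⟨f₂, hf₂, hf₂'⟩ := hD
  refine ⟨fun N => f₁ N + f₂ (N.subgroupOf K), fun N => add_le_add (hf₁ _) (hf₂ _),
    fun N N' hN hN' hle => ?_⟩
  obtain ⟨h₁, h₁'⟩ := hf₁' N N' hN hN' hle
  obtain ⟨h₂, h₂'⟩ := hf₂' (N.subgroupOf K) (N'.subgroupOf K) inferInstance inferInstance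
    (Subgroup.comap_mono hle)
  refine ⟨add_le_add h₁ h₂, fun h => ?_⟩
  replace h₁' := h₁' (by lia)
  replace h₂' := h₂' (by lia)
  intro g hg
  obtain ⟨n, hn, c, hc, rfl⟩ := Subgroup.mem_sup_of_normal_left.1 (h₁' hg)
  have hcN' : c ∈ N' := (Subgroup.mul_mem_cancel_left N' (hle hn)).1 hg
  obtain ⟨c', hc', d, hd, hcd⟩ := Subgroup.mem_sup_of_normal_left.1
    (h₂' (show (⟨c, hc⟩ : K) ∈ N'.subgroupOf K from hcN'))
  have hcd' : (c' : G) * d = c := congrArg Subtype.val hcd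
  rw [← hcd', ← mul_assoc]
  exact Subgroup.mul_mem_sup (mul_mem hn hc') (hDC (Subgroup.mem_map_of_mem _ hd))

theorem NormalLengthLE.add_one_of_supplement {H C : Subgroup G} {D : Subgroup H} {k : ℕ}
    (hD : NormalLengthLE D k) (hDC : D.map H.subtype ≤ C)
    (hH : ∀ N : Subgroup G, N.Normal → N ≤ C ∨ ∀ g, ∃ n ∈ N, n⁻¹ * g ∈ H) :
    NormalLengthLE C (k + 1) := by
  classical
  obtain ⟨f, hf, hf'⟩ := hD
  refine ⟨fun N => if N ≤ C then 0 else f (N.subgroupOf H) + 1, fun N => ?_,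
    fun N N' hN hN' hle => ?_⟩
  · have := hf (N.subgroupOf H)
    dsimp only
    split_ifs <;> lia
  obtain ⟨h₁, h₂⟩ := hf' (N.subgroupOf H) (N'.subgroupOf H) inferInstance inferInstance
    (Subgroup.comap_mono hle)
  by_cases hN'C : N' ≤ C
  · simp [hN'C, hle.trans hN'C]
  by_cases hNC : N ≤ C
  · simp [hN'C, hNC]
  simp only [hN'C, hNC, if_false, add_le_add_iff_right]
  refine ⟨h₁, fun h => ?_⟩
  intro g hg
  obtain ⟨n, hn, hng⟩ := (hH N hN).resolve_left hNC g
  obtain ⟨c, hc, d, hd, hcd⟩ := Subgroup.mem_sup_of_normal_left.1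
    (h₂ h (show (⟨n⁻¹ * g, hng⟩ : H) ∈ N'.subgroupOf H from mul_mem (inv_mem (hle hn)) hg))
  have hcd' : (c : G) * d = n⁻¹ * g := congrArg Subtype.val hcd
  have hg' : g = n * c * d := by rw [mul_assoc, hcd']; group
  rw [hg']
  exact Subgroup.mul_mem_sup (mul_mem hn hc) (hDC (Subgroup.mem_map_of_mem _ hd))

end NormalLength

section Actions

variable {G : Type v} [Group G] {Ω : Type u} (φ : G →* Perm Ω)

/-- The action induced on an invariant subtype. -/
def permRestrict (p : Ω → Prop) (hp : ∀ g x, p (φ g x) ↔ p x) : G →* Perm {x // p x} where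
  toFun g := (φ g).subtypePerm (hp g)
  map_one' := by ext; simp
  map_mul' a b := by ext z; exact congrArg (fun σ : Perm Ω => σ z) (map_mul φ a b)

/-- The equivalence relation whose classes are the orbits of the subgroup `N`. -/
def permOrbitRel (N : Subgroup G) : Setoid Ω where
  r x y := ∃ n ∈ N, φ n x = y
  iseqv :=
    { refl := fun x => ⟨1, one_mem N, by simp⟩
      symm := by
        rintro x _ ⟨n, hn, rfl⟩
        exact ⟨n⁻¹, inv_mem hn, by simp⟩
      trans := by
        rintro x _ _ ⟨n, hn, rfl⟩ ⟨m, hm, rfl⟩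
        exact ⟨m * n, mul_mem hm hn, by simp⟩ }

theorem permOrbitRel_apply {N : Subgroup G} [hN : N.Normal] (g : G) {x y : Ω}
    (h : permOrbitRel φ N x y) : permOrbitRel φ N (φ g x) (φ g y) := by
  obtain ⟨n, hn, rfl⟩ := h
  exact ⟨g * n * g⁻¹, hN.conj_mem n hn g, by simp⟩

/-- The action on the set of orbits of a normal subgroup. -/
def permOrbits (N : Subgroup G) [N.Normal] : G →* Perm (Quotient (permOrbitRel φ N)) where
  toFun g :=
    { toFun := Quotient.map (φ g) fun _ _ => permOrbitRel_apply φ g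
      invFun := Quotient.map (φ g⁻¹) fun _ _ => permOrbitRel_apply φ g⁻¹
      left_inv := by rintro ⟨x⟩; exact congrArg (Quotient.mk _) (by simp)
      right_inv := by rintro ⟨x⟩; exact congrArg (Quotient.mk _) (by simp) }
  map_one' := by ext ⟨x⟩; exact congrArg (Quotient.mk _) (by simp)
  map_mul' a b := by ext ⟨x⟩; exact congrArg (Quotient.mk _) (by simp)

end Actions

/-- For every action on a set of size `n` with an invariant surjection onto `ι`, the normal length
modulo the kernel is at most `n - |ι|`. -/
def NormalLengthBound (n : ℕ) : Prop :=
  ∀ (Ω ι : Type u) [Finite Ω] (G : Type v) [Group G] (φ : G →* Perm Ω) (π : Ω → ι),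
    Function.Surjective π → (∀ g x, π (φ g x) = π x) → Nat.card Ω = n →
      NormalLengthLE φ.ker (n - Nat.card ι)

theorem normalLengthLE_of_nontrivial {n : ℕ} (ih : ∀ m < n, NormalLengthBound.{u, v} m)
    {Ω ι : Type u} [Finite Ω] {G : Type v} [Group G] (φ : G →* Perm Ω) (π : Ω → ι)
    (hπ : Function.Surjective π) (hinv : ∀ g x, π (φ g x) = π x) (hn : Nat.card Ω = n)
    [Nontrivial ι] : NormalLengthLE φ.ker (n - Nat.card ι) := by
  classical
  have : Finite ι := Finite.of_surjective π hπ
  obtain ⟨i, j, hij⟩ := exists_pair_ne ι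
  let p : Ω → Prop := fun x => π x = i
  have hp : ∀ g x, p (φ g x) ↔ p x := fun g x => by simp only [p, hinv]
  have hp' : ∀ g x, ¬ p (φ g x) ↔ ¬ p x := fun g x => not_congr (hp g x)
  let φ₁ := permRestrict φ p hp
  let φ₂ := (permRestrict φ (fun x => ¬ p x) hp').comp φ₁.ker.subtype
  obtain ⟨x, hx⟩ := hπ i
  obtain ⟨y, hy⟩ := hπ j
  have hcard : Nat.card {x // p x} + Nat.card {x // ¬ p x} = n := by
    rw [← Nat.card_sum, Nat.card_congr (Equiv.sumCompl p), hn]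
  have hcardι : 1 + Nat.card {k : ι // ¬ k = i} = Nat.card ι := by
    rw [← Nat.card_congr (Equiv.sumCompl fun k => k = i), Nat.card_sum]
    simp
  have : Nonempty {x // p x} := ⟨⟨x, hx⟩⟩
  have : Nonempty {x // ¬ p x} := ⟨⟨y, fun h => hij (h.symm.trans hy)⟩⟩
  have pos₁ : 0 < Nat.card {x // p x} := Nat.card_pos
  have pos₂ : 0 < Nat.card {x // ¬ p x} := Nat.card_pos
  have h₁ := ih (Nat.card {x // p x}) (by lia) {x // p x} PUnit G φ₁ (fun _ => PUnit.unit)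
    (fun _ => ⟨⟨x, hx⟩, rfl⟩) (fun _ _ => rfl) rfl
  let π₂ : {x // ¬ p x} → {k : ι // ¬ k = i} := fun z => ⟨π z, z.2⟩
  have hπ₂ : Function.Surjective π₂ := by
    rintro ⟨k, hk⟩
    obtain ⟨z, rfl⟩ := hπ k
    exact ⟨⟨z, hk⟩, rfl⟩
  have h₂ := ih (Nat.card {x // ¬ p x}) (by lia) {x // ¬ p x} {k : ι // ¬ k = i} φ₁.ker φ₂ π₂ hπ₂
    (fun g z => Subtype.ext (hinv g z)) rfl
  have hle₂ : Nat.card {k : ι // ¬ k = i} ≤ Nat.card {x // ¬ p x} :=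
    Nat.card_le_card_of_surjective π₂ hπ₂
  refine (h₁.add h₂ (C := φ.ker) ?_).mono le_rfl ?_
  · rintro _ ⟨⟨g, hg⟩, hg₂, rfl⟩
    change φ g = 1
    ext z
    by_cases hz : p z
    · exact congrArg Subtype.val (DFunLike.congr_fun (MonoidHom.mem_ker.1 hg) ⟨z, hz⟩)
    · exact congrArg Subtype.val (DFunLike.congr_fun (MonoidHom.mem_ker.1 hg₂) ⟨z, hz⟩)
  · have : Nat.card PUnit.{u + 1} = 1 := by simp
    lia

theorem normalLengthLE_of_intransitive {n : ℕ} (ih : ∀ m < n, NormalLengthBound.{u, v} m)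
    {Ω : Type u} [Finite Ω] {G : Type v} [Group G] (φ : G →* Perm Ω) (hn : Nat.card Ω = n)
    (N : Subgroup G) [N.Normal] (hN : ¬ N ≤ φ.ker) {x y : Ω} (hxy : ∀ g ∈ N, φ g x ≠ y) :
    NormalLengthLE φ.ker (n - 1) := by
  let Q := Quotient (permOrbitRel φ N)
  have hmk : Function.Surjective (Quotient.mk (permOrbitRel φ N)) := Quotient.mk_surjective
  have : Finite Q := Finite.of_surjective _ hmk
  have : Nontrivial Q := ⟨Quotient.mk _ x, Quotient.mk _ y, fun h => by
    obtain ⟨g, hg, hgx⟩ := Quotient.exact h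
    exact hxy g hg hgx⟩
  have hlt : Nat.card Q < n := by
    rw [← hn]
    refine lt_of_le_of_ne (Nat.card_le_card_of_surjective _ hmk) fun h => hN fun g hg => ?_
    have hinj := (hmk.bijective_of_nat_card_le h.ge).injective
    refine MonoidHom.mem_ker.2 (Equiv.ext fun z => ?_)
    exact (hinj (Quotient.sound ⟨g, hg, rfl⟩)).symm
  have hpos : 0 < Nat.card Q := Nat.card_pos
  have h₁ := ih (Nat.card Q) hlt Q PUnit G (permOrbits φ N) (fun _ => PUnit.unit)
    (fun _ => ⟨Quotient.mk _ x, rfl⟩) (fun _ _ => rfl) rfl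
  have h₂ := normalLengthLE_of_nontrivial ih (φ.comp (permOrbits φ N).ker.subtype)
    (Quotient.mk (permOrbitRel φ N)) hmk
    (fun g z => DFunLike.congr_fun (MonoidHom.mem_ker.1 g.2) (Quotient.mk _ z)) hn
  refine (h₁.add h₂ (C := φ.ker) ?_).mono le_rfl ?_
  · rintro _ ⟨g, hg, rfl⟩
    exact hg
  · have : Nat.card PUnit.{u + 1} = 1 := by simp
    change Nat.card Q - _ + (n - Nat.card Q) ≤ n - 1
    lia

theorem normalLengthLE_of_transitive {n : ℕ} (ih : ∀ m < n, NormalLengthBound.{u, v} m)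
    {Ω : Type u} [Finite Ω] {G : Type v} [Group G] (φ : G →* Perm Ω) (hn : Nat.card Ω = n)
    (hG : ∀ N : Subgroup G, N.Normal → N ≤ φ.ker ∨ ∀ x y, ∃ g ∈ N, φ g x = y)
    [Nontrivial Ω] : NormalLengthLE φ.ker (n - 1) := by
  classical
  obtain ⟨x, y, hxy⟩ := exists_pair_ne Ω
  let H : Subgroup G := (MulAction.stabilizer (Perm Ω) x).comap φ
  have hH : ∀ g, g ∈ H ↔ φ g x = x := fun g => Iff.rfl
  let p : Ω → Prop := fun z => ¬ z = x
  have hp : ∀ (g : H) (z : Ω), p ((φ.comp H.subtype) g z) ↔ p z := by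
    intro g z
    refine not_congr ⟨fun h => (φ g).injective (h.trans ((hH g).1 g.2).symm), ?_⟩
    rintro rfl
    exact (hH g).1 g.2
  have hcard : 1 + Nat.card {z // p z} = n := by
    rw [← hn, ← Nat.card_congr (Equiv.sumCompl fun z => z = x), Nat.card_sum]
    simp [p]
  have : Nonempty {z // p z} := ⟨⟨y, hxy.symm⟩⟩
  have hpos : 0 < Nat.card {z // p z} := Nat.card_pos
  have h := ih (Nat.card {z // p z}) (by lia) {z // p z} PUnit H
    (permRestrict (φ.comp H.subtype) p hp) (fun _ => PUnit.unit)
    (fun _ => ⟨⟨y, hxy.symm⟩, rfl⟩) (fun _ _ => rfl) rfl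
  refine (h.add_one_of_supplement (C := φ.ker) ?_ fun N hN => ?_).mono le_rfl ?_
  · rintro _ ⟨g, hg, rfl⟩
    refine MonoidHom.mem_ker.2 (Equiv.ext fun z => ?_)
    by_cases hz : z = x
    · rw [hz]
      exact (hH g).1 g.2
    · exact congrArg Subtype.val (DFunLike.congr_fun (MonoidHom.mem_ker.1 hg) ⟨z, hz⟩)
  · refine (hG N hN).imp_right fun hN g => ?_
    obtain ⟨m, hm, hmg⟩ := hN x (φ g x)
    exact ⟨m, hm, by simp [hH, ← hmg]⟩
  · have : Nat.card PUnit.{u + 1} = 1 := by simp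
    lia

theorem normalLengthBound (n : ℕ) : NormalLengthBound.{u, v} n := by
  induction n using Nat.strong_induction_on with
  | _ n ih =>
    intro Ω ι _ G _ φ π hπ hinv hn
    have : Finite ι := Finite.of_surjective π hπ
    rcases subsingleton_or_nontrivial ι with hι | hι
    · have hι₁ : n - 1 ≤ n - Nat.card ι := by
        have := Finite.card_le_one_iff_subsingleton.2 hι
        lia
      refine NormalLengthLE.mono ?_ le_rfl hι₁
      rcases subsingleton_or_nontrivial Ω with hΩ | hΩ
      · exact NormalLengthLE.of_eq_top (eq_top_iff.2 fun g _ => Subsingleton.elim _ _) _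
      by_cases hG : ∀ N : Subgroup G, N.Normal → N ≤ φ.ker ∨ ∀ x y, ∃ g ∈ N, φ g x = y
      · exact normalLengthLE_of_transitive ih φ hn hG
      · push Not at hG
        obtain ⟨N, hN, hNker, x, y, hxy⟩ := hG
        exact normalLengthLE_of_intransitive ih φ hn N hNker hxy
    · exact normalLengthLE_of_nontrivial ih φ π hπ hinv hn


/-- Any chief series of a nontrivial subgroup `G ≤ Sym(n)` has length at most `n - 1`. -/
theorem chief_series_length_le (n : ℕ) (hn : 1 ≤ n)
    (G : Subgroup (Equiv.Perm (Fin n))) (hG : G ≠ ⊥)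
    (u : ℕ) (N : Fin (u + 1) → Subgroup G)
    (hmono : StrictMono N) (hbot : N 0 = ⊥) (htop : N (Fin.last u) = ⊤)
    (hnormal : ∀ i, (N i).Normal)
    (hchief : ∀ i : Fin u, ∀ K : Subgroup G, K.Normal →
      ¬ (N i.castSucc < K ∧ K < N i.succ)) :
    u ≤ n - 1 := by
  have : Nonempty (Fin n) := ⟨⟨0, hn⟩⟩
  obtain ⟨f, hf, hf'⟩ := normalLengthBound n (Fin n) PUnit G G.subtype (fun _ => PUnit.unit)
    (fun _ => ⟨⟨0, hn⟩, rfl⟩) (fun _ _ => rfl) (by simp)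
  rw [Nat.card_unique] at hf
  have hmono' : StrictMono fun i => f (N i) := by
    intro i j hij
    by_contra! h
    have hle := (hf' _ _ (hnormal i) (hnormal j) (hmono hij).le).2 h
    rw [Subgroup.ker_subtype, sup_bot_eq] at hle
    exact (hmono hij).not_ge hle
  have hrank : ∀ i : Fin (u + 1), (i : ℕ) ≤ f (N i) := by
    intro i
    induction i using Fin.induction with
    | zero => exact Nat.zero_le _
    | succ i hi => exact Nat.succ_le_of_lt (hi.trans_lt (hmono' i.castSucc_lt_succ))
  exact (hrank (Fin.last u)).trans (hf _)
end
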